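/- arXiv:2311.17714 — 6 statements merged into one kernel-verified Lean document; each statement's English description precedes it below -/
import Mathlib

section
/- Let $(\lambda_k)_{k\in\mathbb{Z}}$ be real numbers with $\lambda_{k+1} - \lambda_k \ge 1$ for all $k$, and let $(a_k)_{k\in\mathbb{Z}}$ be a finitely supported sequence of complex numbers. Then $\int_{-1/2}^{1/2} \left|\sum_{k} a_k e^{2i\pi \lambda_k t}\right|^2 dt \le 2 \sum_k |a_k|^2$. -/
open Real MeasureTheory Finset

open FourierTransform SchwartzMap

open scoped ContDiff

/-- The `L²` Fourier transform of an integrable function is given by the Fourier integral. -/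
theorem coeFn_fourier_toLp_ae_eq {f : ℝ → ℂ} (hf : Integrable f) (hf2 : MemLp f 2) :
    (𝓕 (hf2.toLp f) : Lp (α := ℝ) ℂ 2) =ᵐ[volume] 𝓕 f := by
  have hcont : Continuous (𝓕 f) :=
    VectorFourier.fourierIntegral_continuous continuous_fourierChar
      (by exact continuous_inner) hf
  refine ae_eq_of_integral_contDiff_smul_eq ((Lp.memLp _).locallyIntegrable one_le_two)
    hcont.locallyIntegrable fun g hg hgc ↦ ?_
  have hgc' : HasCompactSupport (Complex.ofRealCLM ∘ g) := hgc.comp_left rfl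
  have hg' : ContDiff ℝ ∞ (Complex.ofRealCLM ∘ g) := by fun_prop
  let φ : 𝓢(ℝ, ℂ) := hgc'.toSchwartzMap hg'
  have hφ : ∀ x, φ x = (g x : ℂ) := fun x ↦ rfl
  have hdist := congrArg (fun T ↦ T φ) (Lp.fourier_toTemperedDistribution_eq (hf2.toLp f))
  simp only [TemperedDistribution.fourier_apply, Lp.toTemperedDistribution_apply] at hdist
  have hflip : ∫ ξ, 𝓕 (φ : ℝ → ℂ) ξ • f ξ = ∫ x, φ x • 𝓕 f x :=
    VectorFourier.integral_fourierIntegral_smul_eq_flip (L := innerₗ ℝ)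
      continuous_fourierChar continuous_inner (φ.integrable (μ := volume)) hf |>.trans (by
        simp only [flip_innerₗ]; rfl)
  calc ∫ x, g x • (𝓕 (hf2.toLp f) : Lp (α := ℝ) ℂ 2 volume) x
      = ∫ x, φ x • (𝓕 (hf2.toLp f) : Lp (α := ℝ) ℂ 2 volume) x := by simp [hφ]
    _ = ∫ x, (𝓕 φ) x • (hf2.toLp f) x := hdist.symm
    _ = ∫ x, (𝓕 (φ : ℝ → ℂ)) x • f x := by
        refine integral_congr_ae ?_
        filter_upwards [hf2.coeFn_toLp] with x hx
        rw [hx, SchwartzMap.fourier_coe]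
    _ = ∫ x, g x • 𝓕 f x := by rw [hflip]; simp [hφ]

theorem memLp_two_fourier {f : ℝ → ℂ} (hf : Integrable f) (hf2 : MemLp f 2) :
    MemLp (𝓕 f) 2 :=
  (Lp.memLp _).ae_eq (coeFn_fourier_toLp_ae_eq hf hf2)

theorem integral_norm_sq_eq_norm_toLp_sq {f : ℝ → ℂ} (hf : MemLp f 2) :
    ∫ x, ‖f x‖ ^ 2 = ‖hf.toLp f‖ ^ 2 := by
  rw [Lp.norm_toLp, MemLp.eLpNorm_eq_integral_rpow_norm two_ne_zero ENNReal.ofNat_ne_top hf,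
    ENNReal.toReal_ofReal (by positivity)]
  rw [← Real.rpow_natCast, ← Real.rpow_mul (by positivity)]
  simp

/-- Plancherel's theorem for functions in `L¹ ∩ L²`. -/
theorem integral_norm_sq_fourier_eq {f : ℝ → ℂ} (hf : Integrable f) (hf2 : MemLp f 2) :
    ∫ x, ‖𝓕 f x‖ ^ 2 = ∫ x, ‖f x‖ ^ 2 := by
  have h : (memLp_two_fourier hf hf2).toLp (𝓕 f) = 𝓕 (hf2.toLp f) :=
    Lp.ext ((MemLp.coeFn_toLp _).trans (coeFn_fourier_toLp_ae_eq hf hf2).symm)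
  rw [integral_norm_sq_eq_norm_toLp_sq hf2,
    integral_norm_sq_eq_norm_toLp_sq (memLp_two_fourier hf hf2), h, Lp.norm_fourier_eq]

/-- One arch of the cosine, `cos (π x)` for `|x| ≤ 1 / 2`, extended by zero. -/
noncomputable def cosArch : ℝ → ℂ :=
  (Set.Ioc (-(1 / 2) : ℝ) (1 / 2)).indicator fun x ↦ (Real.cos (π * x) : ℂ)

theorem memLp_cosArch (p : ENNReal) : MemLp cosArch p := by
  refine (memLp_indicator_iff_restrict measurableSet_Ioc).2 (MemLp.of_bound ?_ 1 ?_)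
  · exact Continuous.aestronglyMeasurable (by fun_prop)
  · exact .of_forall fun x ↦ by
      rw [Complex.norm_real]; exact Real.abs_cos_le_one _

theorem integral_cos_pi_sq :
    ∫ x in (-(1 / 2) : ℝ)..(1 / 2), Real.cos (π * x) ^ 2 = 1 / 2 := by
  rw [intervalIntegral.integral_comp_mul_left (fun y ↦ Real.cos y ^ 2) pi_ne_zero,
    integral_cos_sq]
  have h : π * (1 / 2) = π / 2 := by ring
  rw [mul_neg, h]
  simp
  field_simp

theorem integral_norm_cosArch_sq : ∫ x, ‖cosArch x‖ ^ 2 = 1 / 2 := by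
  rw [← integral_cos_pi_sq, intervalIntegral.integral_of_le (by norm_num),
    ← integral_indicator measurableSet_Ioc]
  congr 1 with x
  by_cases hx : x ∈ Set.Ioc (-(1 / 2) : ℝ) (1 / 2)
  · simp only [cosArch, Set.indicator_of_mem hx, Complex.norm_real, Real.norm_eq_abs, sq_abs]
  · rw [cosArch, Set.indicator_of_notMem hx, Set.indicator_of_notMem hx, norm_zero,
      zero_pow two_ne_zero]

theorem one_half_le_norm_fourier_cosArch {t : ℝ} (ht : |t| ≤ 1 / 2) :
    1 / 2 ≤ ‖𝓕 cosArch t‖ := by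
  have hre : (𝓕 cosArch t).re =
      ∫ x in (-(1 / 2) : ℝ)..(1 / 2), Real.cos (π * x) * Real.cos (2 * π * x * t) := by
    have h : 𝓕 cosArch t = ∫ x in Set.Ioc (-(1 / 2) : ℝ) (1 / 2),
        Complex.exp (↑(-2 * π * x * t) * Complex.I) * (Real.cos (π * x) : ℂ) := by
      rw [fourier_real_eq_integral_exp_smul, ← integral_indicator measurableSet_Ioc]
      congr 1 with x
      by_cases hx : x ∈ Set.Ioc (-(1 / 2) : ℝ) (1 / 2)
      · rw [cosArch, Set.indicator_of_mem hx, Set.indicator_of_mem hx, smul_eq_mul]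
      · rw [cosArch, Set.indicator_of_notMem hx, Set.indicator_of_notMem hx, smul_zero]
    rw [h, intervalIntegral.integral_of_le (by norm_num), ← Complex.reCLM_apply,
      ← ContinuousLinearMap.integral_comp_comm]
    · congr 1 with x
      rw [Complex.reCLM_apply, Complex.re_mul_ofReal, Complex.exp_ofReal_mul_I_re, mul_comm,
        ← Real.cos_neg (2 * π * x * t)]
      ring_nf
    · exact (Continuous.intervalIntegrable (by fun_prop) _ _).1
  refine le_trans ?_ (Complex.re_le_norm _)
  rw [hre]
  refine integral_cos_pi_sq.ge.trans ?_
  refine intervalIntegral.integral_mono_on (by norm_num)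
    (Continuous.intervalIntegrable (by fun_prop) _ _)
    (Continuous.intervalIntegrable (by fun_prop) _ _) fun x hx ↦ ?_
  have hpi := pi_pos
  have hx' : |x| ≤ 1 / 2 := abs_le.2 hx
  have hcos : 0 ≤ Real.cos (π * x) :=
    Real.cos_nonneg_of_neg_pi_div_two_le_of_le (by nlinarith [hx.1]) (by nlinarith [hx.2])
  rw [sq]
  refine mul_le_mul_of_nonneg_left ?_ hcos
  rw [← Real.cos_abs (π * x), ← Real.cos_abs (2 * π * x * t)]
  refine Real.cos_le_cos_of_nonneg_of_le_pi (abs_nonneg _) ?_ ?_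
  · rw [abs_mul, abs_of_pos hpi]; nlinarith
  · rw [abs_mul (2 * π * x), abs_mul (2 * π), abs_mul 2, abs_mul π, abs_of_pos hpi, abs_two]
    nlinarith [mul_nonneg hpi.le (abs_nonneg x)]

theorem add_one_le_of_one_le_gap {lam : ℤ → ℝ} (hlam : ∀ k : ℤ, lam (k + 1) - lam k ≥ 1)
    {j k : ℤ} (hjk : j < k) : lam j + 1 ≤ lam k := by
  have hmono : Monotone lam := monotone_int_of_le_succ fun n ↦ by linarith [hlam n]
  linarith [hlam j, hmono (show j + 1 ≤ k by lia)]

theorem mem_Ioc_of_cosArch_ne_zero {x : ℝ} (hx : cosArch x ≠ 0) :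
    x ∈ Set.Ioc (-(1 / 2) : ℝ) (1 / 2) :=
  Set.mem_of_indicator_ne_zero hx

/-- Translates of `cosArch` along frequencies with gaps at least `1` have disjoint supports. -/
theorem eq_of_cosArch_add_ne_zero {lam : ℤ → ℝ} (hlam : ∀ k : ℤ, lam (k + 1) - lam k ≥ 1)
    {j k : ℤ} {x : ℝ} (hj : cosArch (x + lam j) ≠ 0) (hk : cosArch (x + lam k) ≠ 0) :
    j = k := by
  have hj' := mem_Ioc_of_cosArch_ne_zero hj
  have hk' := mem_Ioc_of_cosArch_ne_zero hk
  rcases lt_trichotomy j k with h | h | h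
  · linarith [add_one_le_of_one_le_gap hlam h, hj'.1, hk'.2]
  · exact h
  · linarith [add_one_le_of_one_le_gap hlam h, hj'.2, hk'.1]

theorem norm_sum_cosArch_sq {lam : ℤ → ℝ} (hlam : ∀ k : ℤ, lam (k + 1) - lam k ≥ 1)
    (s : Finset ℤ) (a : ℤ → ℂ) (x : ℝ) :
    ‖∑ k ∈ s, a k * cosArch (x + lam k)‖ ^ 2
      = ∑ k ∈ s, ‖a k‖ ^ 2 * ‖cosArch (x + lam k)‖ ^ 2 := by
  by_cases h : ∃ j ∈ s, cosArch (x + lam j) ≠ 0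
  · obtain ⟨j, hjs, hj⟩ := h
    have hzero : ∀ k ∈ s, k ≠ j → cosArch (x + lam k) = 0 := fun k _ hkj ↦ by
      by_contra hk
      exact hkj (eq_of_cosArch_add_ne_zero hlam hk hj)
    rw [Finset.sum_eq_single_of_mem j hjs fun k hk hkj ↦ by simp [hzero k hk hkj],
      Finset.sum_eq_single_of_mem j hjs fun k hk hkj ↦ by simp [hzero k hk hkj],
      norm_mul, mul_pow]
  · push Not at h
    rw [Finset.sum_eq_zero fun k hk ↦ by simp [h k hk],
      Finset.sum_eq_zero fun k hk ↦ by simp [h k hk]]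
    simp

theorem memLp_sum_cosArch (lam : ℤ → ℝ) (s : Finset ℤ) (a : ℤ → ℂ) (p : ENNReal) :
    MemLp (fun x ↦ ∑ k ∈ s, a k * cosArch (x + lam k)) p :=
  memLp_finsetSum s fun k _ ↦
    ((memLp_cosArch p).comp_measurePreserving
      (measurePreserving_add_right volume (lam k))).const_mul (a k)

theorem integral_norm_sum_cosArch_sq {lam : ℤ → ℝ}
    (hlam : ∀ k : ℤ, lam (k + 1) - lam k ≥ 1) (s : Finset ℤ) (a : ℤ → ℂ) :
    ∫ x, ‖∑ k ∈ s, a k * cosArch (x + lam k)‖ ^ 2 = (∑ k ∈ s, ‖a k‖ ^ 2) * (1 / 2) := by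
  simp_rw [norm_sum_cosArch_sq hlam]
  rw [integral_finsetSum, Finset.sum_mul]
  · refine Finset.sum_congr rfl fun k _ ↦ ?_
    rw [integral_const_mul, integral_add_right_eq_self (fun x ↦ ‖cosArch x‖ ^ 2),
      integral_norm_cosArch_sq]
  · intro k _
    exact ((memLp_cosArch 2).integrable_norm_pow two_ne_zero).comp_add_right (lam k)
      |>.const_mul _

theorem fourier_sum_cosArch (lam : ℤ → ℝ) (s : Finset ℤ) (a : ℤ → ℂ) (t : ℝ) :
    𝓕 (fun x ↦ ∑ k ∈ s, a k * cosArch (x + lam k)) t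
      = (∑ k ∈ s, a k * Complex.exp (2 * π * Complex.I * lam k * t)) * 𝓕 cosArch t := by
  have hint : ∀ k, Integrable fun x ↦ cosArch (x + lam k) := fun k ↦
    (memLp_one_iff_integrable.1 (memLp_cosArch 1)).comp_add_right (lam k)
  have hshift : ∀ k, ∫ x, 𝐞 (-(x * t)) • cosArch (x + lam k)
      = Complex.exp (2 * π * Complex.I * lam k * t) * 𝓕 cosArch t := fun k ↦ by
    have h := congrFun (Fourier.fourierIntegral_comp_add_right 𝐞 volume cosArch (lam k)) t
    simp only [Fourier.fourierIntegral_def, Function.comp_def] at h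
    rw [h, fourier_real_eq, Circle.smul_def, smul_eq_mul, Real.fourierChar_apply]
    congr 2
    push_cast
    ring
  rw [fourier_real_eq, Finset.sum_mul]
  simp_rw [Finset.smul_sum]
  rw [integral_finsetSum]
  · refine Finset.sum_congr rfl fun k _ ↦ ?_
    rw [mul_assoc, ← hshift, ← integral_const_mul]
    simp only [Circle.smul_def, smul_eq_mul, mul_left_comm]
  · intro k _
    have := (Real.fourierIntegral_convergent_iff (μ := volume) t).2 ((hint k).const_mul (a k))
    simpa [mul_comm] using this

theorem stmt_1 (lam : ℤ → ℝ) (hlam : ∀ k : ℤ, lam (k + 1) - lam k ≥ 1)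
    (s : Finset ℤ) (a : ℤ → ℂ) :
    ∫ t in (-(1 / 2) : ℝ)..(1 / 2),
        ‖∑ k ∈ s, a k * Complex.exp (2 * π * Complex.I * lam k * t)‖ ^ 2
      ≤ 2 * ∑ k ∈ s, ‖a k‖ ^ 2 := by
  set F : ℝ → ℂ := fun x ↦ ∑ k ∈ s, a k * cosArch (x + lam k) with hF
  have hF1 : Integrable F := memLp_one_iff_integrable.1 (memLp_sum_cosArch lam s a 1)
  have hF2 : MemLp F 2 := memLp_sum_cosArch lam s a 2
  have hint : Integrable fun t ↦ 4 * ‖𝓕 F t‖ ^ 2 :=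
    ((memLp_two_fourier hF1 hF2).integrable_norm_pow two_ne_zero).const_mul 4
  calc ∫ t in (-(1 / 2) : ℝ)..(1 / 2),
        ‖∑ k ∈ s, a k * Complex.exp (2 * π * Complex.I * lam k * t)‖ ^ 2
      ≤ ∫ t in (-(1 / 2) : ℝ)..(1 / 2), 4 * ‖𝓕 F t‖ ^ 2 := by
        refine intervalIntegral.integral_mono_on (by norm_num)
          (Continuous.intervalIntegrable (by fun_prop) _ _) hint.intervalIntegrable
          fun t ht ↦ ?_
        have hlow := one_half_le_norm_fourier_cosArch (abs_le.2 ht)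
        rw [hF, fourier_sum_cosArch, norm_mul, mul_pow]
        nlinarith [mul_nonneg (sq_nonneg ‖∑ k ∈ s, a k *
          Complex.exp (2 * π * Complex.I * lam k * t)‖)
          (show 0 ≤ 4 * ‖𝓕 cosArch t‖ ^ 2 - 1 by nlinarith)]
    _ ≤ ∫ t, 4 * ‖𝓕 F t‖ ^ 2 := by
        rw [intervalIntegral.integral_of_le (by norm_num)]
        exact setIntegral_le_integral hint (.of_forall fun t ↦ by positivity)
    _ = 2 * ∑ k ∈ s, ‖a k‖ ^ 2 := by
        rw [integral_const_mul, integral_norm_sq_fourier_eq hF1 hF2,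
          integral_norm_sum_cosArch_sq hlam]
        ring
end

section
/- Let $1 < T \le 2$, $(\lambda_k)_{k\in\mathbb{Z}}$ real numbers with $\lambda_{k+1}-\lambda_k \ge 1$, and $(a_k)$ a finitely supported complex sequence. Then $\int_{-T/2}^{T/2} \left|\sum_k a_k e^{2i\pi\lambda_k t}\right|^2 dt \ge \frac{\pi^2}{8}\frac{T^2-1}{T^2} \sum_k |a_k|^2$. -/
open Real MeasureTheory Finset

theorem abs_cos_pi_mul_le_abs_one_sub (ξ : ℝ) : |cos (π * ξ)| ≤ |1 - 4 * ξ ^ 2| := by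
  have hder : ∀ x ∈ Set.uIcc (0 : ℝ) (1 / 2), HasDerivAt
      (fun x => sin (π * x) * cos (2 * π * ξ * x) - 2 * ξ * (cos (π * x) * sin (2 * π * ξ * x)))
      ((1 - 4 * ξ ^ 2) * (π * cos (π * x)) * cos (2 * π * ξ * x)) x := by
    intro x _
    have h1 : HasDerivAt (fun x : ℝ => π * x) π x := by
      simpa using (hasDerivAt_id x).const_mul π
    have h2 : HasDerivAt (fun x : ℝ => 2 * π * ξ * x) (2 * π * ξ) x := by
      simpa using (hasDerivAt_id x).const_mul (2 * π * ξ)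
    refine ((h1.sin.mul h2.cos).sub ((h1.cos.mul h2.sin).const_mul (2 * ξ))).congr_deriv ?_
    ring
  have hint := intervalIntegral.integral_eq_sub_of_hasDerivAt hder
    (Continuous.intervalIntegrable (by fun_prop) _ _)
  have hone : ∫ x in (0 : ℝ)..(1 / 2), π * cos (π * x) = 1 := by
    rw [intervalIntegral.integral_const_mul,
      intervalIntegral.integral_comp_mul_left _ pi_ne_zero, integral_cos]
    have : π * (1 / 2) = π / 2 := by ring
    rw [this]
    simp [pi_ne_zero]
  have hval : ∫ x in (0 : ℝ)..(1 / 2), (1 - 4 * ξ ^ 2) * (π * cos (π * x)) * cos (2 * π * ξ * x)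
      = cos (π * ξ) := by
    rw [hint, show π * (1 / 2) = π / 2 by ring, show 2 * π * ξ * (1 / 2) = π * ξ by ring]
    simp
  rw [← hval, ← Real.norm_eq_abs]
  calc _ ≤ ∫ x in (0 : ℝ)..(1 / 2), |1 - 4 * ξ ^ 2| * (π * cos (π * x)) := by
        refine intervalIntegral.norm_integral_le_of_norm_le (by norm_num)
          (ae_of_all _ fun x hx => ?_) (Continuous.intervalIntegrable (by fun_prop) _ _)
        have hc : 0 ≤ cos (π * x) := cos_nonneg_of_mem_Icc
          ⟨by nlinarith [pi_pos, hx.1], by nlinarith [pi_pos, hx.2]⟩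
        rw [norm_mul, norm_mul, Real.norm_eq_abs, Real.norm_eq_abs, Real.norm_eq_abs,
          abs_of_nonneg (mul_nonneg pi_pos.le hc)]
        exact mul_le_of_le_one_right (by positivity) (abs_cos_le_one _)
    _ = |1 - 4 * ξ ^ 2| := by rw [intervalIntegral.integral_const_mul, hone, mul_one]

theorem integral_one_sub_mul_cos {c : ℝ} (hc : c ≠ 0) :
    ∫ x in (0 : ℝ)..1, (1 - x) * cos (c * x) = (1 - cos c) / c ^ 2 := by
  have hder : ∀ x ∈ Set.uIcc (0 : ℝ) 1, HasDerivAt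
      (fun x => (1 - x) * (sin (c * x) / c) - cos (c * x) / c ^ 2) ((1 - x) * cos (c * x)) x := by
    intro x _
    have h1 : HasDerivAt (fun x : ℝ => c * x) c x := by
      simpa using (hasDerivAt_id x).const_mul c
    refine ((((hasDerivAt_id x).const_sub 1).mul (h1.sin.div_const c)).sub
      (h1.cos.div_const (c ^ 2))).congr_deriv ?_
    simp only [id]
    field_simp
    ring
  rw [intervalIntegral.integral_eq_sub_of_hasDerivAt hder
    (Continuous.intervalIntegrable (by fun_prop) _ _)]
  simp
  ring

theorem integral_sin_const_mul {c : ℝ} (hc : c ≠ 0) :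
    ∫ x in (0 : ℝ)..1, sin (c * x) = (1 - cos c) / c := by
  rw [intervalIntegral.integral_comp_mul_left _ hc, integral_sin]
  simp
  ring

/-- The restriction to `[0, 1]` of the even function `π² T² H * H + H' * H'`, where
`H x = cos (π x)` on `[-1/2, 1/2]` and `H = 0` elsewhere. -/
noncomputable def inghamProfile (T x : ℝ) : ℝ :=
  π ^ 2 * (T ^ 2 - 1) / 2 * ((1 - x) * cos (π * x)) + π * (T ^ 2 + 1) / 2 * sin (π * x)

/-- The function `π² T² H * H + H' * H'`, where `H x = cos (π x)` on `[-1/2, 1/2]` and `H = 0`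
elsewhere. -/
noncomputable def inghamFun (T x : ℝ) : ℝ := inghamProfile T (min |x| 1)

/-- The Fourier transform of `inghamFun T` (away from `±1/2`). -/
noncomputable def inghamKernel (T ξ : ℝ) : ℝ :=
  4 * (T ^ 2 - 4 * ξ ^ 2) * (cos (π * ξ) / (1 - 4 * ξ ^ 2)) ^ 2

theorem continuous_inghamProfile (T : ℝ) : Continuous (inghamProfile T) := by
  unfold inghamProfile
  fun_prop

theorem continuous_inghamFun (T : ℝ) : Continuous (inghamFun T) :=
  (continuous_inghamProfile T).comp (by fun_prop)

theorem inghamFun_eq_zero (T : ℝ) {x : ℝ} (hx : 1 ≤ |x|) : inghamFun T x = 0 := by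
  simp [inghamFun, inghamProfile, min_eq_right hx]

theorem inghamFun_zero (T : ℝ) : inghamFun T 0 = π ^ 2 * (T ^ 2 - 1) / 2 := by
  simp [inghamFun, inghamProfile]

theorem inghamFun_of_mem (T : ℝ) {x : ℝ} (h0 : 0 ≤ x) (h1 : x ≤ 1) :
    inghamFun T x = inghamProfile T x := by
  rw [inghamFun, abs_of_nonneg h0, min_eq_left h1]

theorem inghamFun_neg (T x : ℝ) : inghamFun T (-x) = inghamFun T x := by
  simp [inghamFun]

theorem integrable_inghamFun (T : ℝ) : Integrable fun x => (inghamFun T x : ℂ) := by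
  refine Continuous.integrable_of_hasCompactSupport
    (Complex.continuous_ofReal.comp (continuous_inghamFun T))
    (HasCompactSupport.intro (isCompact_Icc (a := (-1 : ℝ)) (b := 1)) fun x hx => ?_)
  rw [inghamFun_eq_zero, Complex.ofReal_zero]
  by_contra! h
  exact hx (Set.mem_Icc.mpr (abs_le.mp h.le))

theorem integral_inghamProfile_mul_cos (T : ℝ) {ξ : ℝ} (hξ : 1 - 4 * ξ ^ 2 ≠ 0) :
    ∫ x in (0 : ℝ)..1, inghamProfile T x * cos (2 * π * ξ * x) = inghamKernel T ξ / 2 := by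
  have hp : 1 + 2 * ξ ≠ 0 := fun h => hξ (by linear_combination (1 - 2 * ξ) * h)
  have hm : 1 - 2 * ξ ≠ 0 := fun h => hξ (by linear_combination (1 + 2 * ξ) * h)
  have hp' : π * (1 + 2 * ξ) ≠ 0 := mul_ne_zero pi_ne_zero hp
  have hm' : π * (1 - 2 * ξ) ≠ 0 := mul_ne_zero pi_ne_zero hm
  have hcongr : ∀ x : ℝ, inghamProfile T x * cos (2 * π * ξ * x) =
      π ^ 2 * (T ^ 2 - 1) / 4 * ((1 - x) * cos (π * (1 + 2 * ξ) * x)) +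
      π ^ 2 * (T ^ 2 - 1) / 4 * ((1 - x) * cos (π * (1 - 2 * ξ) * x)) +
      (π * (T ^ 2 + 1) / 4 * sin (π * (1 + 2 * ξ) * x) +
      π * (T ^ 2 + 1) / 4 * sin (π * (1 - 2 * ξ) * x)) := by
    intro x
    rw [show π * (1 + 2 * ξ) * x = π * x + 2 * π * ξ * x by ring,
      show π * (1 - 2 * ξ) * x = π * x - 2 * π * ξ * x by ring,
      cos_add, cos_sub, sin_add, sin_sub, inghamProfile]
    ring
  simp_rw [hcongr]
  rw [intervalIntegral.integral_add (Continuous.intervalIntegrable (by fun_prop) _ _)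
      (Continuous.intervalIntegrable (by fun_prop) _ _),
    intervalIntegral.integral_add (Continuous.intervalIntegrable (by fun_prop) _ _)
      (Continuous.intervalIntegrable (by fun_prop) _ _),
    intervalIntegral.integral_add (Continuous.intervalIntegrable (by fun_prop) _ _)
      (Continuous.intervalIntegrable (by fun_prop) _ _)]
  simp only [intervalIntegral.integral_const_mul]
  rw [integral_one_sub_mul_cos hp', integral_one_sub_mul_cos hm', integral_sin_const_mul hp',
    integral_sin_const_mul hm',
    show π * (1 + 2 * ξ) = 2 * (π * ξ) + π by ring, show π * (1 - 2 * ξ) = π - 2 * (π * ξ) by ring,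
    cos_add_pi, cos_pi_sub, cos_two_mul, inghamKernel,
    show 2 * (π * ξ) + π = π * (1 + 2 * ξ) by ring, show π - 2 * (π * ξ) = π * (1 - 2 * ξ) by ring,
    show 1 - 4 * ξ ^ 2 = (1 + 2 * ξ) * (1 - 2 * ξ) by ring]
  field_simp
  ring

open FourierTransform in
theorem fourier_inghamFun (T : ℝ) {ξ : ℝ} (hξ : 1 - 4 * ξ ^ 2 ≠ 0) :
    𝓕 (fun x : ℝ => (inghamFun T x : ℂ)) ξ = inghamKernel T ξ := by
  set e : ℝ → ℂ := fun x => Complex.exp (↑(-2 * π * x * ξ) * Complex.I) * inghamFun T x with he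
  have hcont : Continuous e := by
    have := continuous_inghamFun T
    fun_prop
  have hI : ∫ x, e x = ∫ x in (-1 : ℝ)..1, e x := by
    rw [intervalIntegral.integral_of_le (by norm_num),
      setIntegral_eq_integral_of_forall_compl_eq_zero]
    intro x hx
    have : inghamFun T x = 0 := by
      refine inghamFun_eq_zero T ?_
      by_contra! h
      exact hx ⟨(abs_lt.mp h).1, (abs_lt.mp h).2.le⟩
    simp [he, this]
  have hneg : ∫ x in (-1 : ℝ)..0, e x = ∫ x in (0 : ℝ)..1, e (-x) := by
    rw [intervalIntegral.integral_comp_neg, neg_zero]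
  rw [Real.fourier_real_eq_integral_exp_smul]
  change ∫ x, e x = _
  rw [hI, ← intervalIntegral.integral_add_adjacent_intervals (b := 0)
    (hcont.intervalIntegrable _ _) (hcont.intervalIntegrable _ _), hneg,
    ← intervalIntegral.integral_add (f := fun x => e (-x))
    ((hcont.comp continuous_neg).intervalIntegrable _ _) (hcont.intervalIntegrable _ _)]
  have hpt : ∀ x ∈ Set.uIcc (0 : ℝ) 1, e (-x) + e x =
      ((2 * (inghamProfile T x * cos (2 * π * ξ * x)) : ℝ) : ℂ) := by
    intro x hx
    rw [Set.uIcc_of_le zero_le_one] at hx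
    simp only [he, inghamFun_neg, inghamFun_of_mem T hx.1 hx.2]
    push_cast
    rw [Complex.cos]
    ring_nf
  rw [intervalIntegral.integral_congr hpt, intervalIntegral.integral_ofReal,
    intervalIntegral.integral_const_mul, integral_inghamProfile_mul_cos T hξ]
  congr 1
  ring

theorem ae_one_sub_four_mul_sq_ne_zero : ∀ᵐ ξ : ℝ, 1 - 4 * ξ ^ 2 ≠ 0 := by
  have h1 : ∀ᵐ ξ : ℝ, ξ ≠ 1 / 2 := Measure.ae_ne volume _
  have h2 : ∀ᵐ ξ : ℝ, ξ ≠ -1 / 2 := Measure.ae_ne volume _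
  filter_upwards [h1, h2] with ξ h1 h2 h
  have : (ξ - 1 / 2) * (ξ - -1 / 2) = 0 := by linear_combination (-1 / 4) * h
  rcases mul_eq_zero.mp this with h | h
  · exact h1 (sub_eq_zero.mp h)
  · exact h2 (sub_eq_zero.mp h)

theorem sq_cos_div_le_one (ξ : ℝ) : (cos (π * ξ) / (1 - 4 * ξ ^ 2)) ^ 2 ≤ 1 := by
  rw [sq_le_one_iff_abs_le_one, abs_div]
  exact div_le_one_of_le₀ (abs_cos_pi_mul_le_abs_one_sub ξ) (abs_nonneg _)

theorem inghamKernel_le (T ξ : ℝ) : inghamKernel T ξ ≤ 4 * T ^ 2 := by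
  have h := sq_cos_div_le_one ξ
  have h0 := sq_nonneg (cos (π * ξ) / (1 - 4 * ξ ^ 2))
  unfold inghamKernel
  nlinarith [mul_nonneg (sq_nonneg ξ) h0, mul_le_mul_of_nonneg_left h (sq_nonneg T)]

theorem inghamKernel_nonpos {T ξ : ℝ} (h : T ^ 2 ≤ 4 * ξ ^ 2) : inghamKernel T ξ ≤ 0 :=
  mul_nonpos_of_nonpos_of_nonneg (by linarith) (sq_nonneg _)

theorem abs_inghamKernel_le (T ξ : ℝ) :
    |inghamKernel T ξ| ≤ 40 * (T ^ 2 + 1) * (1 + ξ ^ 2)⁻¹ := by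
  rw [inghamKernel, abs_mul, abs_of_nonneg (a := (_ / _) ^ 2) (sq_nonneg _),
    le_mul_inv_iff₀ (by positivity)]
  have h := sq_cos_div_le_one ξ
  have h0 := sq_nonneg (cos (π * ξ) / (1 - 4 * ξ ^ 2))
  have hT : |4 * (T ^ 2 - 4 * ξ ^ 2)| ≤ 4 * (T ^ 2 + 1) * (1 + 4 * ξ ^ 2) := by
    rw [abs_le]
    constructor <;> nlinarith [sq_nonneg T, sq_nonneg ξ, mul_nonneg (sq_nonneg T) (sq_nonneg ξ)]
  set q := (cos (π * ξ) / (1 - 4 * ξ ^ 2)) ^ 2 with hq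
  have hkey : (1 + 4 * ξ ^ 2) * (1 + ξ ^ 2) * q ≤ 10 := by
    rcases le_total (ξ ^ 2) 1 with hx | hx
    · calc _ ≤ (1 + 4 * ξ ^ 2) * (1 + ξ ^ 2) * 1 := by gcongr
        _ ≤ 10 := by nlinarith [sq_nonneg ξ]
    · have hpos : 0 < (1 - 4 * ξ ^ 2) ^ 2 := by nlinarith
      rw [hq, div_pow, mul_div_assoc', div_le_iff₀ hpos]
      calc _ ≤ (1 + 4 * ξ ^ 2) * (1 + ξ ^ 2) * 1 := by
            gcongr
            exact cos_sq_le_one _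
        _ ≤ _ := by nlinarith
  calc _ ≤ 4 * (T ^ 2 + 1) * (1 + 4 * ξ ^ 2) * q * (1 + ξ ^ 2) := by gcongr
    _ = 4 * (T ^ 2 + 1) * ((1 + 4 * ξ ^ 2) * (1 + ξ ^ 2) * q) := by ring
    _ ≤ 4 * (T ^ 2 + 1) * 10 := by gcongr
    _ = _ := by ring

theorem integrable_inghamKernel (T : ℝ) : Integrable (inghamKernel T) := by
  refine (integrable_inv_one_add_sq.const_mul (40 * (T ^ 2 + 1))).mono' ?_
    (ae_of_all _ (abs_inghamKernel_le T))
  exact Measurable.aestronglyMeasurable (by unfold inghamKernel; fun_prop)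

open FourierTransform in
theorem integral_inghamKernel_mul_exp (T x : ℝ) :
    ∫ ξ : ℝ, Complex.exp (2 * π * Complex.I * x * ξ) * inghamKernel T ξ = inghamFun T x := by
  have hae : 𝓕 (fun x : ℝ => (inghamFun T x : ℂ)) =ᵐ[volume] fun ξ => (inghamKernel T ξ : ℂ) := by
    filter_upwards [ae_one_sub_four_mul_sq_ne_zero] with ξ hξ using fourier_inghamFun T hξ
  have hinv := congrFun (Continuous.fourierInv_fourier_eq
    (Complex.continuous_ofReal.comp (continuous_inghamFun T)) (integrable_inghamFun T)
    ((integrable_inghamKernel T).ofReal.congr hae.symm)) x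
  rw [Real.fourierInv_eq'] at hinv
  refine Eq.trans (integral_congr_ae ?_) hinv
  filter_upwards [hae] with ξ hξ
  have hξ' : 𝓕 (Complex.ofReal ∘ inghamFun T) ξ = inghamKernel T ξ := hξ
  simp only [hξ', smul_eq_mul, RCLike.inner_apply, conj_trivial]
  push_cast
  congr 2
  ring

theorem one_le_abs_sub_of_step {lam : ℤ → ℝ} (hlam : ∀ k : ℤ, lam (k + 1) - lam k ≥ 1)
    {k l : ℤ} (h : k ≠ l) : 1 ≤ |lam k - lam l| := by
  have hmono : Monotone lam := monotone_int_of_le_succ fun k => by linarith [hlam k]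
  have hlt : ∀ {k l : ℤ}, k < l → 1 ≤ lam l - lam k := fun {k l} hkl => by
    linarith [hlam k, hmono (Int.add_one_le_iff.mpr hkl)]
  rcases lt_or_gt_of_ne h with h | h
  · rw [abs_sub_comm]
    exact (hlt h).trans (le_abs_self _)
  · exact (hlt h).trans (le_abs_self _)

theorem ofReal_norm_sq_expSum (lam : ℤ → ℝ) (s : Finset ℤ) (a : ℤ → ℂ) (t : ℝ) :
    ((‖∑ k ∈ s, a k * Complex.exp (2 * π * Complex.I * lam k * t)‖ ^ 2 : ℝ) : ℂ) =
      ∑ k ∈ s, ∑ l ∈ s, a k * (starRingEnd ℂ) (a l) *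
        Complex.exp (2 * π * Complex.I * ((lam k - lam l : ℝ) : ℂ) * t) := by
  push_cast
  rw [← Complex.mul_conj', map_sum, Finset.sum_mul_sum]
  refine Finset.sum_congr rfl fun k _ => Finset.sum_congr rfl fun l _ => ?_
  rw [map_mul, ← Complex.exp_conj, mul_mul_mul_comm, ← Complex.exp_add]
  congr 2
  simp only [map_mul, Complex.conj_ofReal, Complex.conj_I, map_ofNat]
  ring

theorem integral_norm_sq_expSum_mul_inghamKernel (T : ℝ) {lam : ℤ → ℝ}
    (hlam : ∀ k : ℤ, lam (k + 1) - lam k ≥ 1) (s : Finset ℤ) (a : ℤ → ℂ) :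
    ∫ t : ℝ, ‖∑ k ∈ s, a k * Complex.exp (2 * π * Complex.I * lam k * t)‖ ^ 2 * inghamKernel T t
      = π ^ 2 * (T ^ 2 - 1) / 2 * ∑ k ∈ s, ‖a k‖ ^ 2 := by
  have hint : ∀ k l : ℤ, Integrable fun t : ℝ => a k * (starRingEnd ℂ) (a l) *
      (Complex.exp (2 * π * Complex.I * ((lam k - lam l : ℝ) : ℂ) * t) * inghamKernel T t) := by
    intro k l
    refine Integrable.const_mul ?_ _
    refine (integrable_inghamKernel T).ofReal.bdd_mul (c := 1)
      (Continuous.aestronglyMeasurable (by fun_prop)) (ae_of_all _ fun t => ?_)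
    rw [show 2 * π * Complex.I * ((lam k - lam l : ℝ) : ℂ) * t =
      ((2 * π * (lam k - lam l) * t : ℝ) : ℂ) * Complex.I by push_cast; ring,
      Complex.norm_exp_ofReal_mul_I]
  apply Complex.ofReal_injective
  rw [← integral_complex_ofReal]
  simp_rw [Complex.ofReal_mul _ (inghamKernel T _), ofReal_norm_sq_expSum, Finset.sum_mul,
    mul_assoc (_ * _) (Complex.exp _)]
  rw [integral_finsetSum _ fun k _ => integrable_finsetSum _ fun l _ => hint k l]
  rw [Finset.mul_sum, Complex.ofReal_sum]
  refine Finset.sum_congr rfl fun k hk => ?_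
  rw [integral_finsetSum _ fun l _ => hint k l, Finset.sum_eq_single_of_mem k hk]
  · rw [integral_const_mul, integral_inghamKernel_mul_exp, sub_self, inghamFun_zero,
      Complex.mul_conj']
    push_cast
    ring
  · intro l _ hl
    rw [integral_const_mul, integral_inghamKernel_mul_exp,
      inghamFun_eq_zero T (one_le_abs_sub_of_step hlam hl.symm)]
    simp

theorem stmt_3 (T : ℝ) (hT1 : 1 < T) (hT2 : T ≤ 2)
    (lam : ℤ → ℝ) (hlam : ∀ k : ℤ, lam (k + 1) - lam k ≥ 1)
    (s : Finset ℤ) (a : ℤ → ℂ) :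
    ∫ t in (-(T / 2))..(T / 2),
        ‖∑ k ∈ s, a k * Complex.exp (2 * π * Complex.I * lam k * t)‖ ^ 2
      ≥ π ^ 2 / 8 * ((T ^ 2 - 1) / T ^ 2) * ∑ k ∈ s, ‖a k‖ ^ 2 := by
  set F : ℝ → ℝ := fun t => ‖∑ k ∈ s, a k * Complex.exp (2 * π * Complex.I * lam k * t)‖ ^ 2
    with hF
  have hcont : Continuous F := by fun_prop
  have hF0 : ∀ t, 0 ≤ F t := fun t => by positivity
  have hbound : ∀ t, F t ≤ (∑ k ∈ s, ‖a k‖) ^ 2 := by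
    intro t
    refine pow_le_pow_left₀ (norm_nonneg _) (norm_sum_le_of_le _ fun k _ => ?_) 2
    rw [norm_mul, show 2 * π * Complex.I * lam k * t =
      ((2 * π * lam k * t : ℝ) : ℂ) * Complex.I by push_cast; ring,
      Complex.norm_exp_ofReal_mul_I, mul_one]
  have hFint : Integrable fun t => F t * inghamKernel T t :=
    (integrable_inghamKernel T).bdd_mul hcont.aestronglyMeasurable
      (ae_of_all _ fun t => by rw [Real.norm_of_nonneg (hF0 t)]; exact hbound t)
  have hkey : ∫ t, F t * inghamKernel T t ≤ 4 * T ^ 2 * ∫ t in (-(T / 2))..(T / 2), F t := by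
    rw [intervalIntegral.integral_of_le (by linarith), ← integral_const_mul,
      ← integral_indicator measurableSet_Ioc]
    refine integral_mono hFint (IntegrableOn.integrable_indicator ?_ measurableSet_Ioc) fun t => ?_
    · exact ((hcont.const_mul _).integrableOn_Icc).mono_set Set.Ioc_subset_Icc_self
    · by_cases ht : t ∈ Set.Ioc (-(T / 2)) (T / 2)
      · rw [Set.indicator_of_mem ht, mul_comm]
        exact mul_le_mul_of_nonneg_right (inghamKernel_le T t) (hF0 t)
      · rw [Set.indicator_of_notMem ht]
        refine mul_nonpos_of_nonneg_of_nonpos (hF0 t) (inghamKernel_nonpos ?_)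
        rw [Set.mem_Ioc, not_and_or, not_lt, not_le] at ht
        rcases ht with ht | ht <;> nlinarith
  rw [integral_norm_sq_expSum_mul_inghamKernel T hlam s a] at hkey
  have hT : 0 < 4 * T ^ 2 := by positivity
  rw [ge_iff_le, ← mul_le_mul_iff_right₀ hT]
  refine le_trans (le_of_eq ?_) hkey
  field_simp
  ring
end

section
/- For every constant $C > 0$ there exist a sequence of real numbers $(\lambda_k)_{k\in\mathbb{Z}}$ with $\lambda_{k+1}-\lambda_k \ge 1$ and a finitely supported complex sequence $(a_k)$ such that $\int_{-1/2}^{1/2}\left|\sum_k a_k e^{2i\pi\lambda_k t}\right|^2 dt < C \sum_k |a_k|^2$. In other words, Ingham's lower inequality fails at the critical length $T = 1$. -/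
open Real MeasureTheory Finset

/-- The coefficients of the power series of `(1 + z) ^ (-1 / 2)`. -/
noncomputable def invSqrtCoeff (n : ℕ) : ℝ := Ring.choose (-1 / 2 : ℝ) n

lemma succ_mul_invSqrtCoeff_succ (n : ℕ) :
    (n + 1 : ℝ) * invSqrtCoeff (n + 1) = -(n + 1 / 2) * invSqrtCoeff n := by
  have h := Ring.choose_smul_choose (-1 / 2 : ℝ) (Nat.le_succ n)
  simp only [Nat.succ_eq_add_one, Nat.choose_succ_self_right, add_tsub_cancel_left,
    Ring.choose_one_right, nsmul_eq_mul, Nat.cast_add, Nat.cast_one] at h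
  rw [invSqrtCoeff, invSqrtCoeff, h]
  ring

lemma invSqrtCoeff_zero : invSqrtCoeff 0 = 1 := Ring.choose_zero_right _

lemma abs_invSqrtCoeff_le_one (n : ℕ) : |invSqrtCoeff n| ≤ 1 := by
  induction n with
  | zero => simp [invSqrtCoeff_zero]
  | succ n ih =>
    have h := congrArg abs (succ_mul_invSqrtCoeff_succ n)
    rw [abs_mul, abs_mul, abs_neg, abs_of_pos (a := (n + 1 : ℝ)) (by positivity),
      abs_of_pos (a := (n + 1 / 2 : ℝ)) (by positivity)] at h
    have hn : (0 : ℝ) ≤ n := n.cast_nonneg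
    nlinarith [abs_nonneg (invSqrtCoeff n)]

lemma one_div_le_invSqrtCoeff_sq (n : ℕ) :
    1 / 4 * (1 / (n + 1 : ℝ)) ≤ invSqrtCoeff (n + 1) ^ 2 := by
  induction n with
  | zero =>
    have h := succ_mul_invSqrtCoeff_succ 0
    rw [invSqrtCoeff_zero] at h
    norm_num at h ⊢
    rw [h]
    norm_num
  | succ n ih =>
    have h := succ_mul_invSqrtCoeff_succ (n + 1)
    push_cast at h ⊢
    have hn : (0 : ℝ) ≤ n := n.cast_nonneg
    have h' : invSqrtCoeff (n + 1 + 1) ^ 2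
        = ((n + 3 / 2) / (n + 2)) ^ 2 * invSqrtCoeff (n + 1) ^ 2 := by
      rw [← mul_pow, sq_eq_sq_iff_eq_or_eq_neg]
      right
      field_simp
      linarith
    rw [h']
    refine le_trans ?_ (mul_le_mul_of_nonneg_left ih (by positivity))
    rw [div_pow, div_mul_div_comm, div_mul_div_comm, div_mul_div_comm, div_le_div_iff₀
      (by positivity) (by positivity)]
    nlinarith [mul_nonneg hn hn, mul_nonneg (mul_nonneg hn hn) hn]

lemma tendsto_sum_invSqrtCoeff_sq :
    Filter.Tendsto (fun N ↦ ∑ n ∈ range N, invSqrtCoeff n ^ 2) Filter.atTop Filter.atTop := by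
  rw [← not_summable_iff_tendsto_nat_atTop_of_nonneg fun n ↦ sq_nonneg _]
  intro h
  have h₁ : Summable fun n : ℕ ↦ 1 / 4 * (1 / ((n : ℝ) + 1)) :=
    ((summable_nat_add_iff 1).2 h).of_nonneg_of_le (fun n ↦ by positivity)
      one_div_le_invSqrtCoeff_sq
  have h₂ := (summable_mul_left_iff (by norm_num)).1 h₁
  exact Real.not_summable_one_div_natCast ((summable_nat_add_iff 1).1 (by exact_mod_cast h₂))

lemma sum_antidiagonal_invSqrtCoeff (n : ℕ) :
    ∑ p ∈ antidiagonal n, invSqrtCoeff p.1 * invSqrtCoeff p.2 = (-1) ^ n := by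
  have h := Ring.add_choose_eq n (Commute.all (-1 / 2 : ℝ) (-1 / 2))
  rw [show (-1 / 2 : ℝ) + -1 / 2 = -1 by norm_num, Ring.choose_neg', Ring.multichoose_one] at h
  simp only [invSqrtCoeff]
  rw [← h]
  simp [Int.negOnePow_def, Units.smul_def]

lemma norm_invSqrtCoeff_mul_pow_le (z : ℂ) (n : ℕ) :
    ‖(invSqrtCoeff n : ℂ) * z ^ n‖ ≤ 1 * ‖z‖ ^ n := by
  rw [norm_mul, norm_pow, Complex.norm_real]
  gcongr
  exact abs_invSqrtCoeff_le_one n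

lemma summable_norm_invSqrtCoeff_mul_pow {z : ℂ} (hz : ‖z‖ < 1) :
    Summable fun n ↦ ‖(invSqrtCoeff n : ℂ) * z ^ n‖ :=
  ((summable_geometric_of_lt_one (norm_nonneg z) hz).mul_left 1).of_nonneg_of_le
    (fun _ ↦ norm_nonneg _) (norm_invSqrtCoeff_mul_pow_le z)

lemma tsum_invSqrtCoeff_sq {z : ℂ} (hz : ‖z‖ < 1) :
    (∑' n, (invSqrtCoeff n : ℂ) * z ^ n) ^ 2 = (1 + z)⁻¹ := by
  have hs := summable_norm_invSqrtCoeff_mul_pow hz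
  rw [sq, tsum_mul_tsum_eq_tsum_sum_antidiagonal_of_summable_norm hs hs,
    show 1 + z = 1 - -z by ring, ← tsum_geometric_of_norm_lt_one (by simpa using hz)]
  refine tsum_congr fun n ↦ ?_
  have h := congrArg (fun x : ℝ ↦ (x : ℂ)) (sum_antidiagonal_invSqrtCoeff n)
  push_cast at h
  rw [neg_pow, ← h, sum_mul]
  refine sum_congr rfl fun p hp ↦ ?_
  rw [← mem_antidiagonal.1 hp, pow_add]
  ring

/-- A pointwise bound, for `ε = 1 - r`, on the square of twice the real part of
`exp (3 π i t / 2) (1 + r exp (2 π i t)) ^ (-1 / 2)`. -/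
noncomputable def realPartBound (ε t : ℝ) : ℝ :=
  2 * (ε / (ε ^ 2 + (1 - 2 * t) ^ 2) + ε / (ε ^ 2 + (1 + 2 * t) ^ 2) + 4)

lemma two_mul_re_sq (u : ℂ) : (2 * u.re) ^ 2 = 2 * ‖u ^ 2‖ + 2 * (u ^ 2).re := by
  rw [norm_pow, Complex.sq_norm, Complex.normSq_apply, sq u, Complex.mul_re]
  ring

lemma one_sub_abs_le_cos {t : ℝ} (ht : |t| ≤ 1 / 2) : 1 - 2 * |t| ≤ cos (π * t) := by
  have h := one_sub_mul_le_cos (x := π * |t|) (by positivity) (by nlinarith [pi_pos])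
  rw [← mul_assoc, div_mul_cancel₀ _ pi_ne_zero] at h
  rwa [← cos_abs (π * t), abs_mul, abs_of_pos pi_pos]

lemma div_sq_add_cos_sq_le {ε t : ℝ} (hε : 0 < ε) (ht : |t| ≤ 1 / 2) :
    ε / (ε ^ 2 + cos (π * t) ^ 2)
      ≤ ε / (ε ^ 2 + (1 - 2 * t) ^ 2) + ε / (ε ^ 2 + (1 + 2 * t) ^ 2) := by
  have hc := one_sub_abs_le_cos ht
  have h : ε / (ε ^ 2 + cos (π * t) ^ 2) ≤ ε / (ε ^ 2 + (1 - 2 * |t|) ^ 2) := by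
    gcongr
    linarith
  refine h.trans ?_
  have h₁ : 0 ≤ ε / (ε ^ 2 + (1 - 2 * t) ^ 2) := by positivity
  have h₂ : 0 ≤ ε / (ε ^ 2 + (1 + 2 * t) ^ 2) := by positivity
  rcases abs_cases t with ⟨h, -⟩ | ⟨h, -⟩
  · rw [h]
    linarith
  · rw [h, show 1 - 2 * -t = 1 + 2 * t by ring]
    linarith

lemma norm_one_add_sq (r t : ℝ) :
    ‖1 + r * Complex.exp (2 * π * t * Complex.I)‖ ^ 2
      = (1 - r) ^ 2 + 4 * r * cos (π * t) ^ 2 := by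
  rw [show (2 * π * t * Complex.I : ℂ) = ((2 * (π * t) : ℝ) : ℂ) * Complex.I by push_cast; ring,
    Complex.sq_norm, Complex.normSq_apply]
  simp only [Complex.add_re, Complex.add_im, Complex.one_re, Complex.one_im, Complex.re_ofReal_mul,
    Complex.im_ofReal_mul, Complex.exp_ofReal_mul_I_re, Complex.exp_ofReal_mul_I_im,
    sin_two_mul, cos_two_mul]
  linear_combination 4 * r ^ 2 * cos (π * t) ^ 2 * sin_sq_add_cos_sq (π * t)

lemma re_exp_mul_inv (r t : ℝ) :
    (Complex.exp (3 * π * t * Complex.I) * (1 + r * Complex.exp (2 * π * t * Complex.I))⁻¹).re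
      = (cos (3 * (π * t)) + r * cos (π * t)) /
        ‖1 + r * Complex.exp (2 * π * t * Complex.I)‖ ^ 2 := by
  rw [Complex.sq_norm]
  rw [show (2 * π * t * Complex.I : ℂ) = ((2 * (π * t) : ℝ) : ℂ) * Complex.I by push_cast; ring,
    show (3 * π * t * Complex.I : ℂ) = ((3 * (π * t) : ℝ) : ℂ) * Complex.I by push_cast; ring]
  simp only [Complex.mul_re, Complex.inv_re, Complex.inv_im]
  simp only [Complex.add_re, Complex.add_im, Complex.one_re, Complex.one_im, Complex.re_ofReal_mul,
    Complex.im_ofReal_mul, Complex.exp_ofReal_mul_I_re, Complex.exp_ofReal_mul_I_im]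
  have h : cos (π * t) = cos (3 * (π * t)) * cos (2 * (π * t))
      + sin (3 * (π * t)) * sin (2 * (π * t)) := by
    rw [← cos_sub]
    congr 1
    ring
  rw [h]
  ring

lemma two_mul_re_sq_le {r t : ℝ} (hr : 1 / 4 ≤ r) (hr' : r < 1) (ht : |t| ≤ 1 / 2) {u : ℂ}
    (hu : u ^ 2 = Complex.exp (3 * π * t * Complex.I) *
      (1 + r * Complex.exp (2 * π * t * Complex.I))⁻¹) :
    (2 * u.re) ^ 2 ≤ realPartBound (1 - r) t := by
  have hw := norm_one_add_sq r t
  have hre := re_exp_mul_inv r t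
  have hexp : ‖Complex.exp (3 * π * t * Complex.I)‖ = 1 := by
    exact_mod_cast Complex.norm_exp_ofReal_mul_I (3 * π * t)
  rw [two_mul_re_sq, hu, hre, norm_mul, hexp, norm_inv, one_mul, realPartBound]
  set w := ‖1 + r * Complex.exp (2 * π * t * Complex.I)‖
  have hc : 0 ≤ cos (π * t) := by linarith [one_sub_abs_le_cos ht]
  have hc' : cos (π * t) ≤ 1 := cos_le_one _
  have hbound := div_sq_add_cos_sq_le (sub_pos.2 hr') ht
  rw [cos_three_mul]
  set c := cos (π * t)
  have hε : 0 < 1 - r := sub_pos.2 hr'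
  have hD : (1 - r) ^ 2 + c ^ 2 ≤ w ^ 2 := by nlinarith [sq_nonneg c]
  have hD₀ : 0 < (1 - r) ^ 2 + c ^ 2 := by positivity
  have hw₂ : 0 < w ^ 2 := hD₀.trans_le hD
  have hw₀ : 0 < w := (norm_nonneg _).lt_of_ne' (sq_pos_iff.1 hw₂)
  have hwle : w ≤ (1 - r) + (1 + r) * c := by
    refine (sq_le_sq₀ hw₀.le (by positivity)).1 ?_
    rw [hw]
    nlinarith [mul_nonneg hε.le hc, sq_nonneg ((1 - r) * c)]
  have hnum : w + (4 * c ^ 3 - 3 * c + r * c) ≤ (1 - r) + 4 * c ^ 3 := by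
    nlinarith [mul_nonneg hε.le hc]
  have h₁ : w⁻¹ + (4 * c ^ 3 - 3 * c + r * c) / w ^ 2
      = (w + (4 * c ^ 3 - 3 * c + r * c)) / w ^ 2 := by
    field_simp
  have h₂ : (w + (4 * c ^ 3 - 3 * c + r * c)) / w ^ 2 ≤ ((1 - r) + 4 * c ^ 3) / w ^ 2 := by
    gcongr
  have h₃ : (1 - r) / w ^ 2 ≤ (1 - r) / ((1 - r) ^ 2 + c ^ 2) := by
    gcongr
  have h₄ : 4 * c ^ 3 / w ^ 2 ≤ 4 := by
    rw [div_le_iff₀ hw₂]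
    nlinarith [sq_nonneg c, sq_nonneg (1 - r)]
  rw [add_div (1 - r)] at h₂
  linarith

lemma continuous_realPartBound {ε : ℝ} (hε : 0 < ε) : Continuous (realPartBound ε) := by
  unfold realPartBound
  have h₁ : ∀ t : ℝ, ε ^ 2 + (1 - 2 * t) ^ 2 ≠ 0 := fun t ↦ by positivity
  have h₂ : ∀ t : ℝ, ε ^ 2 + (1 + 2 * t) ^ 2 ≠ 0 := fun t ↦ by positivity
  fun_prop (disch := assumption)

lemma integral_realPartBound_le {ε : ℝ} (hε : 0 < ε) :
    ∫ t in (-(1 / 2) : ℝ)..(1 / 2), realPartBound ε t ≤ 16 := by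
  have hderiv : ∀ t : ℝ, HasDerivAt
      (fun t ↦ arctan ((1 + 2 * t) / ε) - arctan ((1 - 2 * t) / ε) + 8 * t)
      (realPartBound ε t) t := by
    intro t
    have h₁ : HasDerivAt (fun t : ℝ ↦ (1 + 2 * t) / ε) (2 / ε) t := by
      simpa using (((hasDerivAt_id t).const_mul 2).const_add 1).div_const ε
    have h₂ : HasDerivAt (fun t : ℝ ↦ (1 - 2 * t) / ε) (-2 / ε) t := by
      simpa using (((hasDerivAt_id t).const_mul 2).const_sub 1).div_const ε
    have h₃ : HasDerivAt (fun t : ℝ ↦ 8 * t) 8 t := by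
      simpa using (hasDerivAt_id t).const_mul 8
    refine ((h₁.arctan.sub h₂.arctan).add h₃).congr_deriv ?_
    rw [realPartBound]
    field_simp
    ring
  rw [intervalIntegral.integral_eq_sub_of_hasDerivAt (fun t _ ↦ hderiv t)
    ((continuous_realPartBound hε).intervalIntegrable _ _)]
  norm_num
  linarith [arctan_lt_pi_div_two (2 / ε), pi_lt_four]

/-- Partial sums of the real part of `exp (3 π i t / 2) (1 + r exp (2 π i t)) ^ (-1 / 2)`, doubled. -/
noncomputable def inghamSum (r : ℝ) (N : ℕ) (t : ℝ) : ℝ :=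
  2 * (∑ n ∈ range N, ((invSqrtCoeff n * r ^ n : ℝ) : ℂ) *
    Complex.exp (2 * π * Complex.I * (n + 3 / 4) * t)).re

lemma continuous_inghamSum (r : ℝ) (N : ℕ) : Continuous (inghamSum r N) := by
  unfold inghamSum
  fun_prop

lemma inghamSum_sq_le {r t : ℝ} (hr : 1 / 4 ≤ r) (hr' : r < 1) (ht : |t| ≤ 1 / 2) {N : ℕ}
    (hN : r ^ N ≤ (1 - r) / 2) :
    inghamSum r N t ^ 2 ≤ 2 * realPartBound (1 - r) t + 2 := by
  set z : ℂ := r * Complex.exp (2 * π * t * Complex.I) with hz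
  set e : ℂ := Complex.exp (2 * π * Complex.I * (3 / 4) * t) with he
  have hexp : ‖Complex.exp (2 * π * t * Complex.I)‖ = 1 := by
    exact_mod_cast Complex.norm_exp_ofReal_mul_I (2 * π * t)
  have hnz : ‖z‖ = r := by
    rw [hz, norm_mul, hexp, mul_one, Complex.norm_of_nonneg (by linarith)]
  have hne : ‖e‖ = 1 := by
    rw [he, show (2 * π * Complex.I * (3 / 4) * t : ℂ)
      = ((2 * π * (3 / 4) * t : ℝ) : ℂ) * Complex.I by push_cast; ring]
    exact Complex.norm_exp_ofReal_mul_I _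
  have hz₁ : ‖z‖ < 1 := hnz ▸ hr'
  set G : ℂ := ∑' n, (invSqrtCoeff n : ℂ) * z ^ n with hG
  have hsum : ∑ n ∈ range N, ((invSqrtCoeff n * r ^ n : ℝ) : ℂ) *
      Complex.exp (2 * π * Complex.I * (n + 3 / 4) * t)
      = e * ∑ n ∈ range N, (invSqrtCoeff n : ℂ) * z ^ n := by
    rw [mul_sum]
    refine sum_congr rfl fun n _ ↦ ?_
    rw [hz, he, mul_pow, ← Complex.exp_nat_mul, show (2 * π * Complex.I * (n + 3 / 4) * t : ℂ)
      = 2 * π * Complex.I * (3 / 4) * t + n * (2 * π * t * Complex.I) by ring, Complex.exp_add]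
    push_cast
    ring
  have htail : ‖∑ n ∈ range N, (invSqrtCoeff n : ℂ) * z ^ n - G‖ ≤ 1 / 2 := by
    have h := norm_sub_le_of_geometric_bound_of_hasSum hz₁ (norm_invSqrtCoeff_mul_pow_le z)
      (summable_norm_invSqrtCoeff_mul_pow hz₁).of_norm.hasSum N
    refine h.trans ?_
    rw [hnz, one_mul, div_le_iff₀ (by linarith)]
    linarith
  have hu : (e * G) ^ 2 = Complex.exp (3 * π * t * Complex.I) *
      (1 + r * Complex.exp (2 * π * t * Complex.I))⁻¹ := by
    rw [mul_pow, hG, tsum_invSqrtCoeff_sq hz₁, he, ← Complex.exp_nat_mul]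
    congr 2
    push_cast
    ring
  have hmain := two_mul_re_sq_le hr hr' ht hu
  rw [inghamSum, hsum]
  set S := ∑ n ∈ range N, (invSqrtCoeff n : ℂ) * z ^ n
  have hdiff : |(e * S).re - (e * G).re| ≤ 1 / 2 := by
    rw [← Complex.sub_re, ← mul_sub]
    refine (Complex.abs_re_le_norm _).trans ?_
    rwa [norm_mul, hne, one_mul]
  obtain ⟨h₁, h₂⟩ := abs_le.1 hdiff
  nlinarith [sq_nonneg ((e * S).re - 2 * (e * G).re)]

lemma integral_inghamSum_sq_le {r : ℝ} (hr : 1 / 4 ≤ r) (hr' : r < 1) {N : ℕ}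
    (hN : r ^ N ≤ (1 - r) / 2) :
    ∫ t in (-(1 / 2) : ℝ)..(1 / 2), inghamSum r N t ^ 2 ≤ 34 := by
  have hb := continuous_realPartBound (sub_pos.2 hr')
  have hle : ∫ t in (-(1 / 2) : ℝ)..(1 / 2), inghamSum r N t ^ 2
      ≤ ∫ t in (-(1 / 2) : ℝ)..(1 / 2), (2 * realPartBound (1 - r) t + 2) := by
    refine intervalIntegral.integral_mono_on (by norm_num)
      (((continuous_inghamSum r N).pow 2).intervalIntegrable _ _)
      (((hb.const_mul 2).add continuous_const).intervalIntegrable _ _) fun t ht ↦ ?_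
    exact inghamSum_sq_le hr hr' (abs_le.2 ⟨ht.1, ht.2⟩) hN
  rw [intervalIntegral.integral_add ((hb.const_mul 2).intervalIntegrable _ _)
    (continuous_const.intervalIntegrable _ _), intervalIntegral.integral_const_mul,
    intervalIntegral.integral_const] at hle
  have := integral_realPartBound_le (sub_pos.2 hr')
  norm_num at hle this ⊢
  linarith

lemma exists_lt_sum_invSqrtCoeff_sq (A : ℝ) :
    ∃ r : ℝ, 1 / 4 ≤ r ∧ r < 1 ∧ ∃ M : ℕ, A < ∑ n ∈ range M, (invSqrtCoeff n * r ^ n) ^ 2 := by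
  obtain ⟨M, hM⟩ := (tendsto_sum_invSqrtCoeff_sq.eventually_gt_atTop A).exists
  have hcont : Continuous fun r : ℝ ↦ ∑ n ∈ range M, (invSqrtCoeff n * r ^ n) ^ 2 := by fun_prop
  have hev : ∀ᶠ r in nhdsWithin (1 : ℝ) (Set.Iio 1),
      A < ∑ n ∈ range M, (invSqrtCoeff n * r ^ n) ^ 2 :=
    (hcont.continuousAt.eventually_const_lt (by simpa using hM)).filter_mono nhdsWithin_le_nhds
  obtain ⟨r, hr, hr'⟩ := (hev.and (Ico_mem_nhdsLT (by norm_num : (1 / 4 : ℝ) < 1))).exists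
  exact ⟨r, hr'.1, hr'.2, M, hr⟩

/-- The integers of `[-N, N)`, split by sign. -/
def symmetricInterval (N : ℕ) : Finset ℤ :=
  ((range N).disjSum (range N)).map Equiv.intEquivNatSumNat.symm.toEmbedding

lemma sum_symmetricInterval {E : Type*} [AddCommMonoid E] (N : ℕ) (f : ℤ → E) :
    ∑ k ∈ symmetricInterval N, f k
      = ∑ n ∈ range N, f n + ∑ n ∈ range N, f (Int.negSucc n) := by
  rw [symmetricInterval, sum_map, sum_disjSum]
  rfl

/-- The frequencies `k + 3 / 4` for `k ≥ 0` and `k + 1 / 4` for `k < 0`. -/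
noncomputable def inghamFreq (k : ℤ) : ℝ := if 0 ≤ k then k + 3 / 4 else k + 1 / 4

lemma one_le_inghamFreq_sub (k : ℤ) : 1 ≤ inghamFreq (k + 1) - inghamFreq k := by
  unfold inghamFreq
  push_cast
  split_ifs with h₁ h₂
  · linarith
  · linarith
  · omega
  · linarith

lemma inghamFreq_natCast (n : ℕ) : inghamFreq n = n + 3 / 4 := by
  simp [inghamFreq]

lemma inghamFreq_negSucc (n : ℕ) : inghamFreq (Int.negSucc n) = -(n + 3 / 4) := by
  rw [inghamFreq, if_neg (by simp), Int.cast_negSucc]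
  push_cast
  ring

/-- The even extension of a sequence, symmetric about `-1 / 2`. -/
def evenExtension (c : ℕ → ℂ) : ℤ → ℂ
  | Int.ofNat n => c n
  | Int.negSucc n => c n

lemma norm_sum_inghamFreq (r : ℝ) (N : ℕ) (t : ℝ) :
    ‖∑ k ∈ symmetricInterval N, evenExtension (fun n ↦ ((invSqrtCoeff n * r ^ n : ℝ) : ℂ)) k *
      Complex.exp (2 * π * Complex.I * inghamFreq k * t)‖ ^ 2 = inghamSum r N t ^ 2 := by
  have hconj : ∀ n : ℕ, ((invSqrtCoeff n * r ^ n : ℝ) : ℂ) *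
      Complex.exp (2 * π * Complex.I * inghamFreq (Int.negSucc n) * t)
      = (starRingEnd ℂ) (((invSqrtCoeff n * r ^ n : ℝ) : ℂ) *
        Complex.exp (2 * π * Complex.I * (n + 3 / 4) * t)) := by
    intro n
    rw [map_mul, Complex.conj_ofReal, ← Complex.exp_conj, inghamFreq_negSucc]
    congr 2
    simp only [map_mul, map_add, map_div₀, Complex.conj_ofReal, Complex.conj_I, map_ofNat,
      map_natCast]
    push_cast
    ring
  rw [sum_symmetricInterval]
  change ‖∑ n ∈ range N, ((invSqrtCoeff n * r ^ n : ℝ) : ℂ) *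
      Complex.exp (2 * π * Complex.I * inghamFreq (n : ℤ) * t) +
    ∑ n ∈ range N, ((invSqrtCoeff n * r ^ n : ℝ) : ℂ) *
      Complex.exp (2 * π * Complex.I * inghamFreq (Int.negSucc n) * t)‖ ^ 2 = _
  simp only [hconj, inghamFreq_natCast, ← map_sum]
  push_cast
  rw [Complex.add_conj, Complex.norm_real, Real.norm_eq_abs, sq_abs, inghamSum]
  push_cast
  rfl

theorem stmt_5 (C : ℝ) (hC : 0 < C) :
    ∃ (lam : ℤ → ℝ), (∀ k : ℤ, lam (k + 1) - lam k ≥ 1) ∧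
      ∃ (s : Finset ℤ) (a : ℤ → ℂ),
        ∫ t in (-(1 / 2) : ℝ)..(1 / 2),
            ‖∑ k ∈ s, a k * Complex.exp (2 * π * Complex.I * lam k * t)‖ ^ 2
          < C * ∑ k ∈ s, ‖a k‖ ^ 2 := by
  obtain ⟨r, hr, hr', M, hM⟩ := exists_lt_sum_invSqrtCoeff_sq (34 / C)
  obtain ⟨N₀, hN₀⟩ := exists_pow_lt_of_lt_one (show 0 < (1 - r) / 2 by linarith) hr'
  set N := max M N₀
  have hN : r ^ N ≤ (1 - r) / 2 :=
    (pow_le_pow_of_le_one (by linarith) hr'.le (le_max_right _ _)).trans hN₀.le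
  refine ⟨inghamFreq, one_le_inghamFreq_sub, symmetricInterval N,
    evenExtension fun n ↦ ((invSqrtCoeff n * r ^ n : ℝ) : ℂ), ?_⟩
  simp only [norm_sum_inghamFreq]
  refine (integral_inghamSum_sq_le hr hr' hN).trans_lt ?_
  have hnorm : ∀ n : ℕ, ‖((invSqrtCoeff n * r ^ n : ℝ) : ℂ)‖ ^ 2
      = (invSqrtCoeff n * r ^ n) ^ 2 := fun n ↦ by
    rw [Complex.norm_real, Real.norm_eq_abs, sq_abs]
  have hMN : ∑ n ∈ range M, (invSqrtCoeff n * r ^ n) ^ 2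
      ≤ ∑ n ∈ range N, (invSqrtCoeff n * r ^ n) ^ 2 :=
    sum_le_sum_of_subset_of_nonneg (range_mono (le_max_left _ _)) fun _ _ _ ↦ sq_nonneg _
  have hpos : 0 ≤ ∑ n ∈ range N, (invSqrtCoeff n * r ^ n) ^ 2 :=
    sum_nonneg fun _ _ ↦ sq_nonneg _
  rw [← div_lt_iff₀' hC, sum_symmetricInterval]
  change _ < ∑ n ∈ range N, ‖((invSqrtCoeff n * r ^ n : ℝ) : ℂ)‖ ^ 2 +
    ∑ n ∈ range N, ‖((invSqrtCoeff n * r ^ n : ℝ) : ℂ)‖ ^ 2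
  simp only [hnorm]
  linarith
end

section
/- There exists a universal constant $C > 0$ (one may take $C = 1/96$) such that for all integers $n_0 < n_1 < \cdots < n_N$ and all complex numbers $a_0,\ldots,a_N$, $\int_0^1 \left|\sum_{k=0}^N a_k e^{2i\pi n_k t}\right| dt \ge C \sum_{k=0}^N \frac{|a_k|}{k+1}$. -/
open Real MeasureTheory Finset

namespace LittlewoodConjecture

open AddCircle ComplexConjugate

/-- The `L²` norm of a continuous function on the unit circle. -/
noncomputable def l2Norm (f : C(UnitAddCircle, ℂ)) : ℝ :=
  ‖ContinuousMap.toLp 2 haarAddCircle ℂ f‖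

/-- The `n`-th Fourier coefficient as a continuous linear functional on `C(UnitAddCircle, ℂ)`. -/
noncomputable def coeff (n : ℤ) : C(UnitAddCircle, ℂ) →L[ℂ] ℂ :=
  (innerSL ℂ (fourierLp 2 n)).comp (ContinuousMap.toLp 2 haarAddCircle ℂ)

/-- The closed algebra of continuous functions whose spectrum consists of nonpositive integers. -/
noncomputable def antianalytic : Subalgebra ℂ C(UnitAddCircle, ℂ) :=
  (Algebra.adjoin ℂ {fourier (-1)}).topologicalClosure

theorem coeff_apply (n : ℤ) (f : C(UnitAddCircle, ℂ)) :
    coeff n f = ∫ x, f x * conj (fourier n x) ∂haarAddCircle :=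
  ContinuousMap.inner_toLp haarAddCircle (fourier n) f

theorem coeff_fourier_mul (n m : ℤ) (g : C(UnitAddCircle, ℂ)) :
    coeff n (fourier m * g) = coeff (n - m) g := by
  simp only [coeff_apply]
  congr 1
  ext x
  rw [← fourier_neg, ← fourier_neg, ContinuousMap.mul_apply, neg_sub, sub_eq_add_neg, fourier_add]
  ring

theorem coeff_fourier (n m : ℤ) : coeff n (fourier m) = if n = m then 1 else 0 :=
  orthonormal_iff_ite.mp orthonormal_fourier n m

theorem l2Norm_le_mul_of_le {c : ℝ} {f g : C(UnitAddCircle, ℂ)} (h : ∀ x, ‖f x‖ ≤ c * ‖g x‖) :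
    l2Norm f ≤ c * l2Norm g := by
  refine Lp.norm_le_mul_norm_of_ae_le_mul ?_
  filter_upwards [ContinuousMap.coeFn_toLp (p := 2) (𝕜 := ℂ) haarAddCircle f,
    ContinuousMap.coeFn_toLp (p := 2) (𝕜 := ℂ) haarAddCircle g] with x hf hg
  rw [hf, hg]
  exact h x

theorem l2Norm_nonneg (f : C(UnitAddCircle, ℂ)) : 0 ≤ l2Norm f := norm_nonneg _

theorem l2Norm_add_le (f g : C(UnitAddCircle, ℂ)) : l2Norm (f + g) ≤ l2Norm f + l2Norm g := by
  unfold l2Norm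
  rw [map_add]
  exact norm_add_le _ _

theorem l2Norm_sum_le {ι : Type*} (s : Finset ι) (f : ι → C(UnitAddCircle, ℂ)) :
    l2Norm (∑ i ∈ s, f i) ≤ ∑ i ∈ s, l2Norm (f i) := by
  unfold l2Norm
  rw [map_sum]
  exact norm_sum_le _ _

theorem l2Norm_le_of_norm_le {c : ℝ} {f : C(UnitAddCircle, ℂ)} (h : ∀ x, ‖f x‖ ≤ c) :
    l2Norm f ≤ c := by
  have h1 : l2Norm 1 = 1 := by
    have := orthonormal_fourier (T := 1).1 0
    have h0 : (fourier 0 : C(UnitAddCircle, ℂ)) = 1 := by ext x; simp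
    unfold fourierLp at this
    rw [h0] at this
    exact this
  simpa [h1] using l2Norm_le_mul_of_le (g := 1) (c := c) (by simpa using h)

theorem norm_coeff_mul_le (n : ℤ) (f g : C(UnitAddCircle, ℂ)) :
    ‖coeff n (f * g)‖ ≤ l2Norm f * l2Norm g := by
  have h1 : coeff n (f * g) = inner ℂ (ContinuousMap.toLp 2 haarAddCircle ℂ (star f * fourier n))
      (ContinuousMap.toLp 2 haarAddCircle ℂ g) := by
    rw [coeff_apply, ContinuousMap.inner_toLp]
    congr 1
    ext x
    simp
    ring
  rw [h1]
  refine (norm_inner_le_norm _ _).trans (mul_le_mul_of_nonneg_right ?_ (norm_nonneg _))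
  have h2 : l2Norm (star f * fourier n) ≤ 1 * l2Norm f :=
    l2Norm_le_mul_of_le fun x => by
      rw [ContinuousMap.mul_apply, norm_mul, ContinuousMap.star_apply, norm_star, fourier_apply,
        Circle.norm_coe, mul_one, one_mul]
  exact h2.trans_eq (one_mul _)

theorem l2Norm_sq_sum {ι : Type*} (s : Finset ι) (c : ι → ℂ) {e : ι → ℤ}
    (he : Function.Injective e) :
    l2Norm (∑ i ∈ s, c i • fourier (e i)) ^ 2 = ∑ i ∈ s, ‖c i‖ ^ 2 := by
  have h := ((orthonormal_fourier (T := 1)).comp e he).inner_sum c c s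
  have h1 : (∑ i ∈ s, c i • (fourierLp (T := 1) 2 ∘ e) i) =
      ContinuousMap.toLp 2 haarAddCircle ℂ (∑ i ∈ s, c i • fourier (e i)) := by
    simp [fourierLp, map_sum]
  rw [h1, inner_self_eq_norm_sq_to_K] at h
  have h2 : ∀ i, conj (c i) * c i = ((‖c i‖ ^ 2 : ℝ) : ℂ) := fun i => by
    rw [Complex.conj_mul']; simp
  simp only [h2] at h
  refine Complex.ofReal_injective ?_
  push_cast at h ⊢
  exact h

theorem l2Norm_sum_le_of_subset {s t : Finset ℤ} (hst : s ⊆ t) (c : ℤ → ℂ) :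
    l2Norm (∑ n ∈ s, c n • fourier n) ≤ l2Norm (∑ n ∈ t, c n • fourier n) := by
  refine le_of_sq_le_sq ?_ (l2Norm_nonneg _)
  rw [l2Norm_sq_sum (e := fun n => n) s c Function.injective_id,
    l2Norm_sq_sum (e := fun n => n) t c Function.injective_id]
  exact sum_le_sum_of_subset_of_nonneg hst fun _ _ _ => by positivity

theorem fourier_neg_natCast (k : ℕ) :
    (fourier (-k : ℤ) : C(UnitAddCircle, ℂ)) = fourier (-1) ^ k := by
  induction k with
  | zero => ext x; simp
  | succ k ih =>
    ext x
    rw [pow_succ, ← ih, ContinuousMap.mul_apply, ← fourier_add, Nat.cast_succ, neg_add]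

theorem fourier_mem_antianalytic {n : ℤ} (hn : n ≤ 0) : fourier n ∈ antianalytic := by
  obtain ⟨k, rfl⟩ : ∃ k : ℕ, n = -k := ⟨n.natAbs, by omega⟩
  rw [fourier_neg_natCast]
  refine pow_mem (Subalgebra.le_topologicalClosure _ ?_) _
  exact Algebra.subset_adjoin (Set.mem_singleton _)

theorem coeff_eq_zero_of_mem_antianalytic {p : C(UnitAddCircle, ℂ)} (hp : p ∈ antianalytic)
    {n : ℤ} (hn : 0 < n) : coeff n p = 0 := by
  have hcl : IsClosed {q | coeff n q = 0} := isClosed_eq (coeff n).continuous continuous_const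
  refine closure_minimal (fun q hq => ?_) hcl hp
  rw [SetLike.mem_coe, Algebra.adjoin_singleton_eq_range_aeval] at hq
  obtain ⟨P, rfl⟩ := hq
  have hvanish : ∀ k : ℕ, ∀ m : ℤ, 0 < m → coeff m (fourier (-1) ^ k) = 0 := by
    intro k
    induction k with
    | zero =>
      intro m hm
      have h0 : (1 : C(UnitAddCircle, ℂ)) = fourier 0 := by ext x; simp
      rw [pow_zero, h0, coeff_fourier, if_neg hm.ne']
    | succ k ih =>
      intro m hm
      rw [pow_succ', coeff_fourier_mul]
      exact ih _ (by omega)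
  simp [Polynomial.aeval_eq_sum_range, map_sum, hvanish _ n hn]

theorem exp_mem_antianalytic {p : C(UnitAddCircle, ℂ)} (hp : p ∈ antianalytic) :
    NormedSpace.exp p ∈ antianalytic :=
  NormedSpace.exp_mem (Subalgebra.isClosed_topologicalClosure _) hp

theorem exp_apply (p : C(UnitAddCircle, ℂ)) (x : UnitAddCircle) :
    NormedSpace.exp p x = Complex.exp (p x) := by
  rw [NormedSpace.exp_continuousMap_eq, Complex.exp_eq_exp_ℂ]
  rfl

theorem norm_exp_sub_one_le_of_re_nonpos {z : ℂ} (hz : z.re ≤ 0) :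
    ‖Complex.exp z - 1‖ ≤ ‖z‖ := by
  have h := (convex_halfSpace_re_le 0).norm_image_sub_le_of_norm_hasDerivWithin_le
    (f := Complex.exp) (f' := Complex.exp) (C := 1) (x := 0) (y := z)
    (fun w _ => (Complex.hasDerivAt_exp w).hasDerivWithinAt)
    (fun w hw => by simpa [Complex.norm_exp] using hw) (by simp) hz
  simpa using h

/-- A trigonometric polynomial has the same real part as an antianalytic one of comparable
`L²` norm. -/
theorem exists_antianalytic_re_eq {p : C(UnitAddCircle, ℂ)}
    (hp : p ∈ Submodule.span ℂ (Set.range fourier)) :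
    ∃ h ∈ antianalytic, (∀ x, (h x).re = (p x).re) ∧ l2Norm h ≤ 2 * l2Norm p := by
  obtain ⟨c, rfl⟩ := Finsupp.mem_span_range_iff_exists_finsupp.mp hp
  rw [Finsupp.sum]
  set s := c.support
  have hpos : l2Norm (star (∑ n ∈ s with ¬ n ≤ 0, c n • fourier n)) ≤
      l2Norm (∑ n ∈ s, c n • fourier n) := by
    refine (l2Norm_le_mul_of_le (c := 1)
      (g := ∑ n ∈ s with ¬ n ≤ 0, c n • fourier n) fun x => ?_).trans ?_
    · rw [ContinuousMap.star_apply, norm_star, one_mul]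
    · rw [one_mul]
      exact l2Norm_sum_le_of_subset (filter_subset _ _) _
  have hneg : l2Norm (∑ n ∈ s with n ≤ 0, c n • fourier n) ≤
      l2Norm (∑ n ∈ s, c n • fourier n) := l2Norm_sum_le_of_subset (filter_subset _ _) _
  refine ⟨(∑ n ∈ s with n ≤ 0, c n • fourier n) + star (∑ n ∈ s with ¬ n ≤ 0, c n • fourier n),
    add_mem (sum_mem fun n hn => ?_) ?_, fun x => ?_, ?_⟩
  · exact antianalytic.smul_mem (fourier_mem_antianalytic (mem_filter.mp hn).2) _
  · rw [star_sum]
    refine sum_mem fun n hn => ?_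
    have h1 : star (c n • fourier n : C(UnitAddCircle, ℂ)) = conj (c n) • fourier (-n) := by
      ext x; simp
    rw [h1]
    have := (mem_filter.mp hn).2
    exact antianalytic.smul_mem (fourier_mem_antianalytic (by omega)) _
  · rw [← sum_filter_add_sum_filter_not s (fun n => n ≤ 0), ContinuousMap.add_apply,
      ContinuousMap.add_apply, ContinuousMap.star_apply, Complex.add_re, Complex.add_re]
    rfl
  · linarith [l2Norm_add_le (∑ n ∈ s with n ≤ 0, c n • fourier n)
      (star (∑ n ∈ s with ¬ n ≤ 0, c n • fourier n))]

theorem exists_antianalytic_norm_le_re (f : C(UnitAddCircle, ℂ)) {ε : ℝ} (hε : 0 < ε) :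
    ∃ h ∈ antianalytic, (∀ x, ‖f x‖ ≤ (h x).re) ∧ l2Norm h ≤ 2 * (l2Norm f + ε) := by
  let g : C(UnitAddCircle, ℂ) :=
    ⟨fun x => ((‖f x‖ : ℝ) : ℂ), by fun_prop⟩
  let e : C(UnitAddCircle, ℂ) := ContinuousMap.const _ ((ε / 2 : ℝ) : ℂ)
  have hmem : g + e ∈ (Submodule.span ℂ (Set.range (@fourier 1))).topologicalClosure := by
    rw [span_fourier_closure_eq_top]; trivial
  obtain ⟨p, hp, hdist⟩ := Metric.mem_closure_iff.mp hmem (ε / 2) (by positivity)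
  have hclose : ∀ x, ‖(g + e) x - p x‖ ≤ ε / 2 := fun x =>
    (dist_eq_norm ((g + e) x) (p x)) ▸ (ContinuousMap.dist_apply_le_dist x).trans hdist.le
  obtain ⟨h, hh, hre, hnorm⟩ := exists_antianalytic_re_eq hp
  refine ⟨h, hh, fun x => ?_, hnorm.trans ?_⟩
  · have h1 := (Complex.re_le_norm _).trans (hclose x)
    rw [hre]
    simp only [g, e, ContinuousMap.add_apply, ContinuousMap.coe_mk, ContinuousMap.const_apply,
      Complex.sub_re, Complex.add_re, Complex.ofReal_re] at h1
    linarith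
  · have hg : l2Norm g ≤ 1 * l2Norm f := l2Norm_le_mul_of_le fun x => by simp [g]
    have hpg : l2Norm (p - g) ≤ ε := l2Norm_le_of_norm_le fun x => by
      have h1 : (p - g) x = e x - ((g + e) x - p x) := by
        simp only [ContinuousMap.add_apply, ContinuousMap.sub_apply]; ring
      have h2 : ‖e x‖ = ε / 2 := by
        simp only [e, ContinuousMap.const_apply, Complex.norm_real, norm_eq_abs]
        exact abs_of_pos (by positivity)
      rw [h1]
      linarith [norm_sub_le (e x) ((g + e) x - p x), hclose x]
    have := l2Norm_add_le g (p - g)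
    rw [add_sub_cancel] at this
    linarith

/-- If the functions `f j` are bounded by `1` with geometrically decaying `L²` norms, then their sum
can be corrected to a bounded function, at the cost of a small perturbation of the coefficients at
the frequencies lying to the right of the spectrum of the first `f j`. -/
theorem exists_bounded_with_coeff_near_sum (m : ℕ) (f : ℕ → C(UnitAddCircle, ℂ))
    (hf : ∀ j x, ‖f j x‖ ≤ 1) (hf2 : ∀ j, l2Norm (f j) ≤ (1 / 2) ^ j) :
    ∃ F : C(UnitAddCircle, ℂ), (∀ x, ‖F x‖ ≤ 33) ∧
      ∀ (l : ℕ) (n : ℤ), (∀ j < l, ∀ p ∈ antianalytic, coeff n (f j * p) = 0) →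
        ‖coeff n F - ∑ j ∈ range m, coeff n (f j)‖ ≤ (1 / 4) ^ l / 6 := by
  choose h hmem hre hnorm using fun j =>
    exists_antianalytic_norm_le_re (f j) (ε := (1 / 2) ^ j) (by positivity)
  have hh : ∀ j, l2Norm (h j) ≤ 4 * (1 / 2) ^ j := fun j => by linarith [hnorm j, hf2 j]
  let H : ℕ → ℕ → C(UnitAddCircle, ℂ) := fun j m =>
    (-(1 / 32) : ℂ) • ∑ i ∈ Ico (j + 1) m, h i
  let F : ℕ → C(UnitAddCircle, ℂ) := fun m => ∑ j ∈ range m, f j * NormedSpace.exp (H j m)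
  have hrec : ∀ m, F (m + 1) = F m * NormedSpace.exp ((-(1 / 32) : ℂ) • h m) + f m := by
    intro m
    have hlast : H m (m + 1) = 0 := by simp [H]
    have hstep : ∀ j ∈ range m, H j (m + 1) = H j m + (-(1 / 32) : ℂ) • h m := by
      intro j hj
      simp only [H]
      rw [sum_Ico_succ_top (by simpa using hj)]
      exact smul_add (-(1 / 32) : ℂ) (∑ i ∈ Ico (j + 1) m, h i) (h m)
    simp only [F]
    rw [sum_range_succ, hlast, NormedSpace.exp_zero, mul_one, sum_mul]
    congr 1
    refine sum_congr rfl fun j hj => ?_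
    rw [hstep j hj, NormedSpace.exp_add, mul_assoc]
  have hbound : ∀ m x, ‖F m x‖ ≤ 33 := by
    intro m x
    induction m with
    | zero => simp [F]
    | succ m ih =>
      have hexp : ‖NormedSpace.exp ((-(1 / 32) : ℂ) • h m) x‖ ≤ 1 / (1 + ‖f m x‖ / 32) := by
        rw [exp_apply, Complex.norm_exp]
        have h1 : (((-(1 / 32) : ℂ) • h m) x).re ≤ -(‖f m x‖ / 32) := by
          have h2 : ((-(1 / 32) : ℂ) • h m) x = ((-(1 / 32) : ℝ) : ℂ) * h m x := by simp
          rw [h2, Complex.re_ofReal_mul]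
          linarith [hre m x]
        refine (exp_le_exp.mpr h1).trans ?_
        rw [Real.exp_neg, ← one_div]
        exact one_div_le_one_div_of_le (by positivity) (by linarith [add_one_le_exp (‖f m x‖ / 32)])
      rw [hrec, ContinuousMap.add_apply, ContinuousMap.mul_apply]
      refine (norm_add_le _ _).trans ?_
      rw [norm_mul]
      have h3 := mul_le_mul ih hexp (norm_nonneg _) (by norm_num)
      refine (add_le_add_left h3 _).trans ?_
      have h4 := hf m x
      have h5 := norm_nonneg (f m x)
      generalize ‖f m x‖ = y at h4 h5
      rw [mul_one_div, ← le_sub_iff_add_le, div_le_iff₀ (by positivity)]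
      nlinarith
  refine ⟨F m, hbound m, fun l n hln => ?_⟩
  have hH : ∀ j, H j m ∈ antianalytic := fun j =>
    antianalytic.smul_mem (sum_mem fun i _ => hmem i) _
  have hl2 : ∀ j, l2Norm (NormedSpace.exp (H j m) - 1) ≤ 1 / 8 * (1 / 2) ^ j := by
    intro j
    have h1 : l2Norm (NormedSpace.exp (H j m) - 1) ≤
        1 / 32 * l2Norm (∑ i ∈ Ico (j + 1) m, h i) := by
      refine l2Norm_le_mul_of_le fun x => ?_
      have h2 : H j m x = ((-(1 / 32) : ℝ) : ℂ) * (∑ i ∈ Ico (j + 1) m, h i) x := by simp [H]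
      have h3 : 0 ≤ ((∑ i ∈ Ico (j + 1) m, h i) x).re := by
        rw [ContinuousMap.sum_apply, Complex.re_sum]
        exact sum_nonneg fun i _ => (norm_nonneg _).trans (hre i x)
      rw [ContinuousMap.sub_apply, exp_apply, ContinuousMap.one_apply]
      refine (norm_exp_sub_one_le_of_re_nonpos ?_).trans_eq ?_
      · rw [h2, Complex.re_ofReal_mul]
        linarith
      · rw [h2, norm_mul, Complex.norm_real]
        norm_num
    have h4 : ∑ i ∈ Ico (j + 1) m, l2Norm (h i) ≤ 4 * (1 / 2) ^ j :=
      calc ∑ i ∈ Ico (j + 1) m, l2Norm (h i)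
          ≤ 4 * ∑ i ∈ Ico (j + 1) m, (1 / 2 : ℝ) ^ i := by
            rw [mul_sum]; exact sum_le_sum fun i _ => hh i
        _ ≤ 4 * ((1 / 2) ^ (j + 1) / (1 - 1 / 2)) := by
            gcongr
            exact geom_sum_Ico_le_of_lt_one (by norm_num) (by norm_num)
        _ = 4 * (1 / 2) ^ j := by rw [pow_succ]; ring
    linarith [l2Norm_sum_le (Ico (j + 1) m) h]
  have hdiff : coeff n (F m) - ∑ j ∈ range m, coeff n (f j) =
      ∑ j ∈ Ico l m, coeff n (f j * (NormedSpace.exp (H j m) - 1)) := by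
    have hsub : Ico l m ⊆ range m := fun j hj => by simp at hj ⊢; omega
    rw [sum_subset hsub, map_sum, ← sum_sub_distrib]
    · exact sum_congr rfl fun j _ => by rw [← map_sub, mul_sub, mul_one]
    · intro j hj hjl
      refine hln j (by simp at hj hjl; omega) _ ?_
      exact sub_mem (exp_mem_antianalytic (hH j)) (one_mem _)
  rw [hdiff]
  calc ‖∑ j ∈ Ico l m, coeff n (f j * (NormedSpace.exp (H j m) - 1))‖
      ≤ ∑ j ∈ Ico l m, 1 / 8 * (1 / 4 : ℝ) ^ j := by
        refine norm_sum_le_of_le _ fun j _ => (norm_coeff_mul_le _ _ _).trans ?_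
        refine (mul_le_mul (hf2 j) (hl2 j) (l2Norm_nonneg _) (by positivity)).trans_eq ?_
        rw [mul_left_comm, ← mul_pow]
        norm_num
    _ ≤ 1 / 8 * ((1 / 4) ^ l / (1 - 1 / 4)) := by
        rw [← mul_sum]
        gcongr
        exact geom_sum_Ico_le_of_lt_one (by norm_num) (by norm_num)
    _ = (1 / 4) ^ l / 6 := by ring

theorem card_filter_log_le (s : Finset ℕ) (j : ℕ) :
    (#{k ∈ s | Nat.log 4 (k + 1) = j} : ℝ) ≤ 3 * 4 ^ j := by
  have hsub : {k ∈ s | Nat.log 4 (k + 1) = j} ⊆ Ico (4 ^ j - 1) (4 ^ j - 1 + 3 * 4 ^ j) := by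
    intro k hk
    obtain rfl := (mem_filter.mp hk).2
    have h1 := Nat.pow_log_le_self 4 (Nat.succ_ne_zero k)
    have h2 := Nat.lt_pow_succ_log_self (b := 4) (by norm_num) (k + 1)
    rw [pow_succ] at h2
    simp only [Nat.succ_eq_add_one] at h1
    rw [mem_Ico]
    omega
  have h := card_le_card hsub
  rw [Nat.card_Ico, Nat.add_sub_cancel_left] at h
  exact_mod_cast h

/-- A bounded function whose coefficient at the `k`-th frequency is close to a prescribed number
of size comparable to `1 / (k + 1)`. -/
theorem exists_bounded_with_coeff_near (N : ℕ) {n : ℕ → ℤ} (hn : StrictMono n) {u : ℕ → ℂ}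
    (hu : ∀ k, ‖u k‖ ≤ 1) :
    ∃ F : C(UnitAddCircle, ℂ), (∀ x, ‖F x‖ ≤ 33) ∧ ∀ k ∈ range (N + 1),
      ‖coeff (n k) F - ((1 / 4 : ℝ) ^ Nat.log 4 (k + 1) / 3 : ℝ) * u k‖ ≤
        (1 / 4 : ℝ) ^ Nat.log 4 (k + 1) / 6 := by
  let c : ℕ → ℂ := fun k => ((1 / 4 : ℝ) ^ Nat.log 4 (k + 1) / 3 : ℝ) * u k
  let S : ℕ → Finset ℕ := fun j => {k ∈ range (N + 1) | Nat.log 4 (k + 1) = j}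
  let f : ℕ → C(UnitAddCircle, ℂ) := fun j => ∑ k ∈ S j, c k • fourier (n k)
  have hc : ∀ j, ∀ k ∈ S j, ‖c k‖ ≤ (1 / 4 : ℝ) ^ j / 3 := by
    intro j k hk
    obtain rfl := (mem_filter.mp hk).2
    simp only [c]
    rw [norm_mul, Complex.norm_real, norm_of_nonneg (by positivity)]
    exact mul_le_of_le_one_right (by positivity) (hu k)
  have hcard : ∀ j, (#(S j) : ℝ) * ((1 / 4 : ℝ) ^ j / 3) ≤ 1 := by
    intro j
    refine (mul_le_mul_of_nonneg_right (card_filter_log_le _ j) (by positivity)).trans_eq ?_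
    rw [one_div, inv_pow]
    field_simp
  have hbound : ∀ j x, ‖f j x‖ ≤ 1 := by
    intro j x
    simp only [f, ContinuousMap.sum_apply]
    refine (norm_sum_le_of_le (f := fun k => (c k • fourier (n k) : C(UnitAddCircle, ℂ)) x) _
      fun k hk => ?_).trans ((sum_const ((1 / 4 : ℝ) ^ j / 3)).trans_le ?_)
    · rw [ContinuousMap.smul_apply, norm_smul, fourier_apply, Circle.norm_coe, mul_one]
      exact hc j k hk
    · rw [nsmul_eq_mul]
      exact hcard j
  have hl2 : ∀ j, l2Norm (f j) ≤ (1 / 2) ^ j := by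
    intro j
    refine le_of_sq_le_sq ?_ (by positivity)
    rw [l2Norm_sq_sum _ _ hn.injective, ← pow_mul, mul_comm j 2, pow_mul]
    calc ∑ k ∈ S j, ‖c k‖ ^ 2 ≤ ∑ k ∈ S j, ((1 / 4 : ℝ) ^ j / 3) ^ 2 :=
          sum_le_sum fun k hk => pow_le_pow_left₀ (norm_nonneg _) (hc j k hk) 2
      _ = (#(S j) * ((1 / 4 : ℝ) ^ j / 3)) * ((1 / 4 : ℝ) ^ j / 3) := by
          rw [sum_const, nsmul_eq_mul]; ring
      _ ≤ 1 * (1 / 4 : ℝ) ^ j := by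
          refine mul_le_mul (hcard j) ?_ (by positivity) zero_le_one
          exact div_le_self (by positivity) (by norm_num)
      _ = ((1 / 2) ^ 2) ^ j := by norm_num
  obtain ⟨F, hF, hcoeff⟩ := exists_bounded_with_coeff_near_sum (N + 1) f hbound hl2
  refine ⟨F, hF, fun k hk => ?_⟩
  have hsum : ∑ j ∈ range (N + 1), coeff (n k) (f j) = c k := by
    have h1 : ∀ j, coeff (n k) (f j) = if Nat.log 4 (k + 1) = j then c k else 0 := by
      intro j
      have hk' : k < N + 1 := mem_range.mp hk
      simp [f, map_sum, coeff_fourier, hn.injective.eq_iff, S, hk']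
    have h2 : Nat.log 4 (k + 1) < N + 1 :=
      (Nat.log_lt_self 4 (Nat.succ_ne_zero k)).trans_le (mem_range.mp hk)
    simp [h1, h2]
  change ‖coeff (n k) F - c k‖ ≤ _
  rw [← hsum]
  refine hcoeff _ _ fun j hj p hp => ?_
  simp only [f]
  rw [sum_mul, map_sum]
  refine sum_eq_zero fun i hi => ?_
  rw [smul_mul_assoc, map_smul, coeff_fourier_mul, coeff_eq_zero_of_mem_antianalytic hp, smul_zero]
  have hik : i < k := by
    by_contra! hki
    rw [← (mem_filter.mp hi).2] at hj
    exact hj.not_ge (Nat.log_mono_right (by omega))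
  exact sub_pos.mpr (hn hik)

theorem integral_norm_ge (N : ℕ) {n : ℕ → ℤ} (hn : StrictMono n) (a : ℕ → ℂ) :
    1 / 198 * ∑ k ∈ range (N + 1), ‖a k‖ / (k + 1) ≤
      ∫ x : UnitAddCircle, ‖(∑ k ∈ range (N + 1), a k • fourier (n k) : C(UnitAddCircle, ℂ)) x‖
        ∂haarAddCircle := by
  obtain ⟨F, hF, hcoeff⟩ := exists_bounded_with_coeff_near N hn (u := fun k => a k / ‖a k‖)
    fun k => by
      rw [norm_div, Complex.norm_real, norm_norm]
      exact div_self_le_one _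
  set P : C(UnitAddCircle, ℂ) := ∑ k ∈ range (N + 1), a k • fourier (n k) with hP
  have hpair : ∫ x, P x * conj (F x) ∂haarAddCircle =
      ∑ k ∈ range (N + 1), a k * conj (coeff (n k) F) := by
    rw [← ContinuousMap.inner_toLp haarAddCircle F P, hP, map_sum, inner_sum]
    refine sum_congr rfl fun k _ => ?_
    rw [map_smul, inner_smul_right]
    congr 1
    exact (inner_conj_symm _ _).symm
  have hupper : ‖∫ x, P x * conj (F x) ∂haarAddCircle‖ ≤ (∫ x, ‖P x‖ ∂haarAddCircle) * 33 := by
    rw [← integral_mul_const]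
    refine norm_integral_le_of_norm_le ?_ (Filter.Eventually.of_forall fun x => ?_)
    · exact ((map_continuous P).norm.mul continuous_const).integrable_of_hasCompactSupport
        (HasCompactSupport.of_compactSpace _)
    · rw [norm_mul, RCLike.norm_conj]
      exact mul_le_mul_of_nonneg_left (hF x) (norm_nonneg _)
  have hlower : 1 / 6 * ∑ k ∈ range (N + 1), ‖a k‖ / (k + 1) ≤
      (∫ x, P x * conj (F x) ∂haarAddCircle).re := by
    rw [hpair, Complex.re_sum, mul_sum]
    refine sum_le_sum fun k hk => ?_
    have hk := hcoeff k hk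
    have hweight : 1 / ((k : ℝ) + 1) ≤ (1 / 4) ^ Nat.log 4 (k + 1) := by
      rw [one_div_pow]
      refine one_div_le_one_div_of_le (by positivity) ?_
      exact_mod_cast Nat.pow_log_le_self 4 (Nat.succ_ne_zero k)
    generalize (1 / 4 : ℝ) ^ Nat.log 4 (k + 1) = r at hk hweight
    set b := coeff (n k) F
    have hself : a k * conj (a k / ‖a k‖) = ‖a k‖ := by
      by_cases h0 : a k = 0
      · simp [h0]
      · have h1 : (‖a k‖ : ℂ) ≠ 0 := by simpa using h0
        rw [map_div₀, Complex.conj_ofReal, mul_div_assoc', Complex.mul_conj']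
        field_simp
    have hsplit : a k * conj b =
        ((r / 3 * ‖a k‖ : ℝ) : ℂ) + a k * conj (b - (r / 3 : ℝ) * (a k / ‖a k‖)) := by
      rw [map_sub, map_mul, Complex.conj_ofReal, mul_sub, mul_left_comm, hself]
      push_cast
      ring
    have herr : -(‖a k‖ * (r / 6)) ≤ (a k * conj (b - (r / 3 : ℝ) * (a k / ‖a k‖))).re := by
      refine (abs_le.mp ((Complex.abs_re_le_norm _).trans ?_)).1
      rw [norm_mul, RCLike.norm_conj]
      exact mul_le_mul_of_nonneg_left hk (norm_nonneg _)
    rw [hsplit, Complex.add_re, Complex.ofReal_re, div_eq_mul_one_div ‖a k‖]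
    linarith [mul_le_mul_of_nonneg_left hweight (norm_nonneg (a k))]
  linarith [Complex.re_le_norm (∫ x, P x * conj (F x) ∂haarAddCircle)]

theorem exists_strictMono_eqOn {N : ℕ} {n : ℕ → ℤ} (hn : ∀ k < N, n k < n (k + 1)) :
    ∃ n' : ℕ → ℤ, StrictMono n' ∧ ∀ k ≤ N, n' k = n k := by
  refine ⟨fun k => n (min k N) + (k - min k N : ℕ), strictMono_nat_of_lt_succ fun k => ?_,
    fun k hk => by simp [hk]⟩
  rcases lt_or_ge k N with hk | hk
  · simpa [min_eq_left hk.le, min_eq_left (Nat.succ_le_of_lt hk)] using hn k hk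
  · simp only [min_eq_right hk, min_eq_right (hk.trans k.le_succ)]
    omega

end LittlewoodConjecture

theorem stmt_12 :
    ∃ C : ℝ, 0 < C ∧
      ∀ (N : ℕ) (n : ℕ → ℤ) (a : ℕ → ℂ),
        (∀ k < N, n k < n (k + 1)) →
        (∫ t in (0 : ℝ)..1,
            ‖∑ k ∈ Finset.range (N + 1),
                a k * Complex.exp (2 * π * Complex.I * (n k : ℂ) * t)‖)
          ≥ C * ∑ k ∈ Finset.range (N + 1), ‖a k‖ / (k + 1) := by
  refine ⟨1 / 198, by norm_num, fun N n a hn => ?_⟩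
  obtain ⟨n', hmono, heq⟩ := LittlewoodConjecture.exists_strictMono_eqOn hn
  refine (LittlewoodConjecture.integral_norm_ge N hmono a).trans_eq ?_
  have h := AddCircle.intervalIntegral_preimage (1 : ℝ) 0 fun x : UnitAddCircle =>
    ‖(∑ k ∈ range (N + 1), a k • fourier (n' k) : C(UnitAddCircle, ℂ)) x‖
  rw [AddCircle.integral_haarAddCircle, inv_one, one_smul, ← h, zero_add]
  refine intervalIntegral.integral_congr fun t _ => ?_
  simp only [ContinuousMap.sum_apply, ContinuousMap.smul_apply, smul_eq_mul]
  refine congrArg _ (sum_congr rfl fun k hk => ?_)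
  rw [fourier_coe_apply, heq k (by simpa [Nat.lt_succ_iff] using hk), Complex.ofReal_one, div_one]
end

section
/- For all integers $n_0 < n_1 < \cdots < n_N$, $\int_0^1 \left|\sum_{k=0}^N e^{2i\pi n_k t}\right| dt \ge C_{MPS}\, \ln(N+1)$, where $C_{MPS}$ is the constant from the Mc Gehee–Pigno–Smith inequality. -/
open Real MeasureTheory Finset

open AddCircle Polynomial

lemma ContinuousMap.integrable_haarAddCircle {E : Type*} [NormedAddCommGroup E]
    (f : C(UnitAddCircle, E)) : Integrable f (haarAddCircle (T := 1)) :=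
  f.continuous.integrable_of_hasCompactSupport (HasCompactSupport.of_compactSpace _)

lemma Continuous.integrable_haarAddCircle {E : Type*} [NormedAddCommGroup E]
    {f : UnitAddCircle → E} (hf : Continuous f) : Integrable f (haarAddCircle (T := 1)) :=
  ContinuousMap.integrable_haarAddCircle ⟨f, hf⟩

/-- The mean of a continuous function over the unit circle, as a continuous linear functional. -/
noncomputable def circleMean : C(UnitAddCircle, ℂ) →L[ℂ] ℂ :=
  LinearMap.mkContinuous
    { toFun := fun f => ∫ t, f t ∂haarAddCircle
      map_add' := fun f g =>
        integral_add f.integrable_haarAddCircle g.integrable_haarAddCircle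
      map_smul' := fun c f => integral_smul c f } 1 (fun f => by
    simpa using norm_integral_le_of_norm_le_const (μ := haarAddCircle (T := 1))
      (Filter.Eventually.of_forall f.norm_coe_le_norm))

lemma circleMean_apply (f : C(UnitAddCircle, ℂ)) :
    circleMean f = ∫ t, f t ∂haarAddCircle := rfl

lemma norm_circleMean_le (f : C(UnitAddCircle, ℂ)) :
    ‖circleMean f‖ ≤ ∫ t, ‖f t‖ ∂haarAddCircle :=
  norm_integral_le_integral_norm _

lemma circleMean_fourier (n : ℤ) :
    circleMean (fourier n) = if n = 0 then 1 else 0 := by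
  rw [circleMean_apply]
  split_ifs with h
  · simp [h]
  · exact integral_eq_zero_of_add_right_eq_neg (μ := haarAddCircle)
      (fourier_add_half_inv_index h one_pos)

lemma fourier_mul_fourier (m n : ℤ) :
    (fourier m * fourier n : C(UnitAddCircle, ℂ)) = fourier (m + n) := by
  ext t
  exact fourier_add.symm

lemma fourier_one_pow (n : ℕ) :
    (fourier 1 : C(UnitAddCircle, ℂ)) ^ n = fourier (n : ℤ) := by
  induction n with
  | zero => ext t; simp
  | succ n ih => rw [pow_succ, ih, fourier_mul_fourier]; norm_cast

lemma circleMean_aeval (p : ℂ[X]) :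
    circleMean (aeval (fourier 1) p) = p.coeff 0 := by
  induction p using Polynomial.induction_on' with
  | add p q hp hq => simp [hp, hq]
  | monomial n c =>
    rw [aeval_monomial, fourier_one_pow, ← Algebra.smul_def, map_smul, circleMean_fourier,
      coeff_monomial]
    simp

lemma circleMean_fourier_mul_exp {m : ℤ} (hm : 0 < m) (q : ℂ[X]) :
    circleMean (fourier m * NormedSpace.exp (aeval (fourier 1) q)) = 0 := by
  lift m to ℕ using hm.le
  have hsum := ((NormedSpace.exp_series_hasSum_exp' (𝕂 := ℂ)
    (aeval (fourier 1 : C(UnitAddCircle, ℂ)) q)).mul_left (fourier (m : ℤ))).mapL circleMean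
  refine hsum.unique ?_
  convert hasSum_zero with k
  have : (fourier (m : ℤ) : C(UnitAddCircle, ℂ)) * aeval (fourier 1) q ^ k
      = aeval (fourier 1) (X ^ m * q ^ k) := by
    simp [fourier_one_pow]
  rw [mul_smul_comm, map_smul, this, circleMean_aeval, mul_coeff_zero, coeff_X_pow]
  have : (0 : ℕ) ≠ m := by exact_mod_cast hm.ne
  simp [this]

lemma normedSpaceExp_apply (f : C(UnitAddCircle, ℂ)) (t : UnitAddCircle) :
    NormedSpace.exp f t = Complex.exp (f t) := by
  have := NormedSpace.map_exp (ContinuousMap.evalAlgHom ℂ ℂ t)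
    (continuous_eval_const t) f
  rw [Complex.exp_eq_exp_ℂ]
  exact this

lemma exists_polynomial_re_eq {f : C(UnitAddCircle, ℂ)}
    (hf : f ∈ Submodule.span ℂ (Set.range (fourier (T := 1)))) (c : ℂ) :
    ∃ p : ℂ[X], (p.coeff 0).im = 0 ∧
      ∀ t, (aeval (fourier 1 : C(UnitAddCircle, ℂ)) p t).re = (c * f t).re := by
  induction hf using Submodule.span_induction generalizing c with
  | zero => exact ⟨0, by simp, by simp⟩
  | add f g _ _ hf hg =>
    obtain ⟨p, hp, hpf⟩ := hf c
    obtain ⟨q, hq, hqg⟩ := hg c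
    refine ⟨p + q, by simp [hp, hq], fun t => ?_⟩
    rw [map_add, ContinuousMap.add_apply, ContinuousMap.add_apply, Complex.add_re, hpf, hqg,
      mul_add, Complex.add_re]
  | smul a f _ hf =>
    obtain ⟨p, hp, hpf⟩ := hf (c * a)
    exact ⟨p, hp, fun t => by rw [hpf, mul_assoc]; rfl⟩
  | mem f hf =>
    obtain ⟨n, rfl⟩ := hf
    have haeval : ∀ (k : ℕ) (b : ℂ) (t : UnitAddCircle),
        aeval (fourier 1 : C(UnitAddCircle, ℂ)) (monomial k b) t = b * fourier k t :=
      fun k b t => by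
        rw [aeval_monomial, fourier_one_pow, ← Algebra.smul_def]
        rfl
    rcases lt_trichotomy n 0 with hn | rfl | hn
    · obtain ⟨k, rfl⟩ : ∃ k : ℕ, n = -k := ⟨n.natAbs, by omega⟩
      have hk : k ≠ 0 := by omega
      refine ⟨monomial k (starRingEnd ℂ c), by simp [coeff_monomial, hk], fun t => ?_⟩
      rw [haeval, fourier_neg, ← Complex.conj_re, map_mul, Complex.conj_conj]
    · refine ⟨monomial 0 (c.re : ℂ), by simp, fun t => ?_⟩
      rw [haeval]
      simp
    · lift n to ℕ using hn.le
      have hk : n ≠ 0 := by omega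
      exact ⟨monomial n c, by simp [coeff_monomial, hk], fun t => by rw [haeval]⟩

lemma integral_norm_sq_aeval_le {p : ℂ[X]} (hp : (p.coeff 0).im = 0) :
    ∫ t, ‖aeval (fourier 1 : C(UnitAddCircle, ℂ)) p t‖ ^ 2 ∂haarAddCircle ≤
      2 * ∫ t, (aeval (fourier 1 : C(UnitAddCircle, ℂ)) p t).re ^ 2 ∂haarAddCircle := by
  set h := aeval (fourier 1 : C(UnitAddCircle, ℂ)) p with hh
  have hsq : 0 ≤ ∫ t, ((h ^ 2) t).re ∂haarAddCircle := by
    have h1 : ∫ t, ((h ^ 2) t).re ∂haarAddCircle = (circleMean (h ^ 2)).re :=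
      integral_re (h ^ 2).integrable_haarAddCircle
    rw [h1, hh, ← map_pow, circleMean_aeval, pow_two, mul_coeff_zero, Complex.mul_re, hp]
    nlinarith [mul_self_nonneg (p.coeff 0).re]
  have hi1 : Integrable (fun t => 2 * (h t).re ^ 2) (haarAddCircle (T := 1)) :=
    Continuous.integrable_haarAddCircle (by fun_prop)
  have hi2 : Integrable (fun t => ((h ^ 2) t).re) (haarAddCircle (T := 1)) :=
    Continuous.integrable_haarAddCircle (by fun_prop)
  calc ∫ t, ‖h t‖ ^ 2 ∂haarAddCircle
      = ∫ t, (2 * (h t).re ^ 2 - ((h ^ 2) t).re) ∂haarAddCircle := by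
        congr with t
        rw [Complex.sq_norm, Complex.normSq_apply, ContinuousMap.pow_apply, pow_two (h t),
          Complex.mul_re]
        ring
    _ ≤ _ := by
        rw [integral_sub hi1 hi2, integral_const_mul]
        linarith

lemma exists_polynomial_norm_le_re (f : C(UnitAddCircle, ℂ)) {η : ℝ} (hη : 0 < η) :
    ∃ p : ℂ[X], (∀ t, ‖f t‖ ≤ (aeval (fourier 1 : C(UnitAddCircle, ℂ)) p t).re) ∧
      ∫ t, ‖aeval (fourier 1 : C(UnitAddCircle, ℂ)) p t‖ ^ 2 ∂haarAddCircle ≤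
        4 * ∫ t, ‖f t‖ ^ 2 ∂haarAddCircle + η := by
  set δ := √η / 4 with hδ
  have hδ0 : 0 < δ := by positivity
  have hδη : 16 * δ ^ 2 = η := by
    rw [hδ, div_pow, Real.sq_sqrt hη.le]; ring
  let F : C(UnitAddCircle, ℂ) := ⟨fun t => (‖f t‖ : ℂ), by fun_prop⟩
  have hF : F ∈ (Submodule.span ℂ (Set.range (fourier (T := 1)))).topologicalClosure := by
    rw [span_fourier_closure_eq_top]; trivial
  obtain ⟨g, hg, hgF⟩ := Metric.mem_closure_iff.1 hF δ hδ0
  obtain ⟨p, hp, hpg⟩ := exists_polynomial_re_eq hg 1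
  have hclose : ∀ t, |‖f t‖ - (g t).re| ≤ δ := fun t => by
    have h1 : ‖F t - g t‖ ≤ δ :=
      ((F - g).norm_coe_le_norm t).trans (by rw [← dist_eq_norm]; exact hgF.le)
    simpa [F] using (Complex.abs_re_le_norm _).trans h1
  have hre : ∀ t, (aeval (fourier 1 : C(UnitAddCircle, ℂ)) (p + C (δ : ℂ)) t).re
      = (g t).re + δ := fun t => by
    rw [map_add, ContinuousMap.add_apply, Complex.add_re, hpg]
    simp
  refine ⟨p + C (δ : ℂ), fun t => ?_, (integral_norm_sq_aeval_le (by simp [hp])).trans ?_⟩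
  · rw [hre]
    linarith [(abs_le.1 (hclose t)).2]
  · have hi : Integrable (fun t => 2 * ‖f t‖ ^ 2) (haarAddCircle (T := 1)) :=
      Continuous.integrable_haarAddCircle (by fun_prop)
    have : ∫ t, (aeval (fourier 1 : C(UnitAddCircle, ℂ)) (p + C (δ : ℂ)) t).re ^ 2 ∂haarAddCircle
        ≤ ∫ t, (2 * ‖f t‖ ^ 2 + 8 * δ ^ 2) ∂haarAddCircle := by
      refine integral_mono (Continuous.integrable_haarAddCircle (by fun_prop))
        (Continuous.integrable_haarAddCircle (by fun_prop)) fun t => ?_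
      simp only [hre]
      have h1 := abs_le.1 (hclose t)
      have h2 : ((g t).re + δ) ^ 2 ≤ (‖f t‖ + 2 * δ) ^ 2 :=
        pow_le_pow_left₀ (by linarith [norm_nonneg (f t)]) (by linarith) 2
      nlinarith [sq_nonneg (‖f t‖ - 2 * δ)]
    rw [integral_add hi (integrable_const _), integral_const_mul, integral_const] at this
    simp only [probReal_univ, one_smul] at this
    linarith

lemma norm_exp_neg_sub_one_le {z : ℂ} (hz : 0 ≤ z.re) : ‖Complex.exp (-z) - 1‖ ≤ ‖z‖ := by
  have h := (convex_halfSpace_re_ge 0).norm_image_sub_le_of_norm_hasDerivWithin_le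
    (f := fun z => Complex.exp (-z)) (f' := fun z => -Complex.exp (-z)) (C := 1) (x := 0) (y := z)
    (fun w _ => by simpa using (hasDerivAt_neg w).cexp.hasDerivWithinAt)
    (fun w hw => by simpa [Complex.norm_exp] using hw) (by simp) (by simpa using hz)
  simpa using h

lemma norm_sum_mul_exp_le {ε M : ℝ} (hε : 0 < ε) (hM : ε * M ≤ 1) {f h : ℕ → ℂ}
    (hfM : ∀ j, ‖f j‖ ≤ M) (hfh : ∀ j, ‖f j‖ ≤ (h j).re) (m : ℕ) :
    ‖∑ j ∈ range m, f j * Complex.exp (-(ε * ∑ i ∈ Ico (j + 1) m, h i))‖ ≤ 2 / ε := by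
  induction m with
  | zero => simp; positivity
  | succ m ih =>
    have hstep : ∑ j ∈ range (m + 1), f j * Complex.exp (-(ε * ∑ i ∈ Ico (j + 1) (m + 1), h i))
        = (∑ j ∈ range m, f j * Complex.exp (-(ε * ∑ i ∈ Ico (j + 1) m, h i)))
          * Complex.exp (-(ε * h m)) + f m := by
      rw [sum_range_succ, sum_mul]
      congr 1
      · refine sum_congr rfl fun j hj => ?_
        rw [sum_Ico_succ_top (by simpa using hj), mul_assoc, ← Complex.exp_add]
        ring_nf
      · simp
    rw [hstep]
    set y := ε * ‖f m‖ with hy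
    have hy0 : 0 ≤ y := by positivity
    have hy1 : y ≤ 1 := (mul_le_mul_of_nonneg_left (hfM m) hε.le).trans hM
    have hexp : ‖Complex.exp (-(ε * h m))‖ ≤ 1 - y / 2 := by
      rw [Complex.norm_exp]
      have h1 : (-((ε : ℂ) * h m)).re ≤ -y := by
        simpa [hy] using mul_le_mul_of_nonneg_left (hfh m) hε.le
      refine (Real.exp_le_exp.2 h1).trans ?_
      rw [Real.exp_neg]
      refine inv_le_of_inv_le₀ (by linarith) ((inv_le_iff_one_le_mul₀ (by linarith)).2 ?_)
      nlinarith [Real.add_one_le_exp y]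
    calc _ ≤ 2 / ε * (1 - y / 2) + ‖f m‖ := by
          refine (norm_add_le _ _).trans (add_le_add_left ?_ _)
          rw [norm_mul]
          exact mul_le_mul ih hexp (norm_nonneg _) (by positivity)
      _ = 2 / ε := by rw [hy]; field_simp; ring

lemma integral_norm_mul_norm_le {f h : C(UnitAddCircle, ℂ)} {A B : ℝ} (hA : 0 < A) (hB : 0 < B)
    (hf : ∫ t, ‖f t‖ ^ 2 ∂haarAddCircle ≤ A ^ 2) (hh : ∫ t, ‖h t‖ ^ 2 ∂haarAddCircle ≤ B ^ 2) :
    ∫ t, ‖f t‖ * ‖h t‖ ∂haarAddCircle ≤ A * B := by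
  calc ∫ t, ‖f t‖ * ‖h t‖ ∂haarAddCircle
      ≤ ∫ t, (B / (2 * A) * ‖f t‖ ^ 2 + A / (2 * B) * ‖h t‖ ^ 2) ∂haarAddCircle := by
        refine integral_mono (Continuous.integrable_haarAddCircle (by fun_prop))
          (Continuous.integrable_haarAddCircle (by fun_prop)) fun t => ?_
        have : B / (2 * A) * ‖f t‖ ^ 2 + A / (2 * B) * ‖h t‖ ^ 2 - ‖f t‖ * ‖h t‖
            = (B * ‖f t‖ - A * ‖h t‖) ^ 2 / (2 * A * B) := by field_simp; ring
        have h2 : 0 ≤ (B * ‖f t‖ - A * ‖h t‖) ^ 2 / (2 * A * B) := by positivity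
        simp only
        linarith
    _ = B / (2 * A) * ∫ t, ‖f t‖ ^ 2 ∂haarAddCircle
          + A / (2 * B) * ∫ t, ‖h t‖ ^ 2 ∂haarAddCircle := by
        rw [integral_add (Continuous.integrable_haarAddCircle (by fun_prop))
          (Continuous.integrable_haarAddCircle (by fun_prop)), integral_const_mul,
          integral_const_mul]
    _ ≤ B / (2 * A) * A ^ 2 + A / (2 * B) * B ^ 2 := by gcongr
    _ = A * B := by field_simp; ring

lemma integral_norm_sq_sum_fourier (s : Finset ℕ) (u : ℕ → ℂ) {ν : ℕ → ℤ}
    (hν : Set.InjOn ν s) :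
    ∫ t, ‖(∑ k ∈ s, u k • fourier (ν k) : C(UnitAddCircle, ℂ)) t‖ ^ 2 ∂haarAddCircle
      = ∑ k ∈ s, ‖u k‖ ^ 2 := by
  set f : C(UnitAddCircle, ℂ) := ∑ k ∈ s, u k • fourier (ν k) with hf
  have hstar : star f = ∑ k ∈ s, star (u k) • fourier (-ν k) := by
    ext t
    simp [hf, -fourier_apply, fourier_neg]
  have hmean : circleMean (f * star f) = ∑ k ∈ s, (‖u k‖ : ℂ) ^ 2 := by
    rw [hstar, hf, sum_mul_sum, map_sum]
    refine sum_congr rfl fun k hk => ?_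
    rw [map_sum, sum_eq_single_of_mem k hk]
    · rw [smul_mul_smul_comm, map_smul, fourier_mul_fourier, circleMean_fourier]
      simp [Complex.mul_conj']
    · intro l hl hlk
      rw [smul_mul_smul_comm, map_smul, fourier_mul_fourier, circleMean_fourier, if_neg, smul_zero]
      intro h
      exact hlk (hν hl hk (by omega))
  have h1 : ((∫ t, ‖f t‖ ^ 2 ∂haarAddCircle : ℝ) : ℂ) = circleMean (f * star f) := by
    rw [circleMean_apply, ← integral_complex_ofReal]
    congr with t
    simp [Complex.mul_conj']
  rw [hmean] at h1
  exact_mod_cast h1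

/-- The indices `k ≤ N` with `4 ^ j ≤ k + 1 < 4 ^ (j + 1)`. -/
def logBlock (N j : ℕ) : Finset ℕ := {k ∈ range (N + 1) | Nat.log 4 (k + 1) = j}

lemma card_logBlock_le (N j : ℕ) : #(logBlock N j) ≤ 3 * 4 ^ j := by
  have hsub : logBlock N j ⊆ Ico (4 ^ j - 1) (4 ^ (j + 1) - 1) := fun k hk => by
    obtain ⟨_, rfl⟩ := Finset.mem_filter.1 hk
    have h1 := Nat.pow_log_le_self 4 k.succ_ne_zero
    have h2 := Nat.lt_pow_succ_log_self (b := 4) (by norm_num) (k + 1)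
    simp only [Finset.mem_Ico, Nat.succ_eq_add_one] at *
    omega
  have h := card_le_card hsub
  rw [Nat.card_Ico, pow_succ] at h
  have := Nat.one_le_pow j 4 (by norm_num)
  omega

/-- The normalised trigonometric polynomial carried by one block of indices. -/
noncomputable def blockSum (N : ℕ) (n : ℕ → ℤ) (u : ℕ → ℂ) (j : ℕ) : C(UnitAddCircle, ℂ) :=
  ((1 / 4 : ℂ) ^ j) • ∑ k ∈ logBlock N j, u k • fourier (-n k)

section Blocks

variable {N : ℕ} {n : ℕ → ℤ} {u : ℕ → ℂ}

lemma norm_blockSum_apply_le (hu : ∀ k, ‖u k‖ ≤ 1) (j : ℕ) (t : UnitAddCircle) :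
    ‖blockSum N n u j t‖ ≤ 3 := by
  have h1 : ‖(∑ k ∈ logBlock N j, u k • fourier (-n k) : C(UnitAddCircle, ℂ)) t‖
      ≤ 3 * 4 ^ j := by
    rw [ContinuousMap.sum_apply]
    refine (norm_sum_le_of_le (logBlock N j) (f := fun k => (u k • fourier (-n k)) t)
      (n := fun _ => (1 : ℝ)) fun k _ => ?_).trans ?_
    · rw [ContinuousMap.smul_apply, norm_smul, fourier_apply, Circle.norm_coe, mul_one]
      exact hu k
    · simpa using (Nat.cast_le (α := ℝ)).2 (card_logBlock_le N j)
  rw [blockSum, ContinuousMap.smul_apply, norm_smul]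
  calc _ ≤ (1 / 4 : ℝ) ^ j * (3 * 4 ^ j) := by
        refine mul_le_mul (by simp) h1 (norm_nonneg _) (by positivity)
    _ = 3 := by rw [mul_left_comm, ← mul_pow]; norm_num

lemma injOn_of_lt (hn : ∀ i j, i < j → j ≤ N → n i < n j) :
    Set.InjOn n (range (N + 1)) := by
  intro i hi j hj hij
  simp only [coe_range, Set.mem_Iio] at hi hj
  rcases lt_trichotomy i j with h | h | h
  · exact absurd hij (hn i j h (by omega)).ne
  · exact h
  · exact absurd hij (hn j i h (by omega)).ne'

lemma integral_norm_sq_blockSum_le (hn : ∀ i j, i < j → j ≤ N → n i < n j)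
    (hu : ∀ k, ‖u k‖ ≤ 1) (j : ℕ) :
    ∫ t, ‖blockSum N n u j t‖ ^ 2 ∂haarAddCircle ≤ 3 * (1 / 4) ^ j := by
  have hinj : Set.InjOn (fun k => -n k) (logBlock N j) := fun x hx y hy hxy =>
    injOn_of_lt hn (Finset.filter_subset _ _ hx) (Finset.filter_subset _ _ hy) (neg_injective hxy)
  have h1 := integral_norm_sq_sum_fourier (logBlock N j) u hinj
  have h2 : ∑ k ∈ logBlock N j, ‖u k‖ ^ 2 ≤ 3 * 4 ^ j := by
    refine (sum_le_card_nsmul _ _ 1 fun k _ => pow_le_one₀ (norm_nonneg _) (hu k)).trans ?_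
    simpa using (Nat.cast_le (α := ℝ)).2 (card_logBlock_le N j)
  simp only [blockSum, ContinuousMap.smul_apply (_ : ℂ), norm_smul, mul_pow]
  rw [integral_const_mul, h1]
  calc _ ≤ ((1 / 4 : ℝ) ^ j) ^ 2 * (3 * 4 ^ j) := by
        refine mul_le_mul (by simp) h2 (by positivity) (by positivity)
    _ = 3 * (1 / 4) ^ j * ((1 / 4) ^ j * 4 ^ j) := by ring
    _ = 3 * (1 / 4) ^ j := by rw [← mul_pow]; norm_num

lemma circleMean_fourier_mul_blockSum (hn : ∀ i j, i < j → j ≤ N → n i < n j) {k : ℕ}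
    (hk : k ≤ N) (j : ℕ) :
    circleMean (fourier (n k) * blockSum N n u j)
      = if Nat.log 4 (k + 1) = j then (1 / 4) ^ j * u k else 0 := by
  have hterm : ∀ i ∈ logBlock N j,
      circleMean (fourier (n k) * u i • fourier (-n i)) = if i = k then u i else 0 := by
    intro i hi
    rw [mul_smul_comm, map_smul, fourier_mul_fourier, circleMean_fourier, smul_eq_mul]
    have : n k + -n i = 0 ↔ i = k := by
      rw [← sub_eq_add_neg, sub_eq_zero, eq_comm]
      exact (injOn_of_lt hn).eq_iff (Finset.filter_subset _ _ hi) (by simp; omega)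
    simp [this]
  rw [blockSum, mul_smul_comm, map_smul, mul_sum, map_sum, sum_congr rfl hterm, sum_ite_eq']
  simp [logBlock, hk]

lemma circleMean_fourier_mul_blockSum_mul_exp (hn : ∀ i j, i < j → j ≤ N → n i < n j) {j k : ℕ}
    (hk : k ≤ N) (hj : j < Nat.log 4 (k + 1)) (q : ℂ[X]) :
    circleMean (fourier (n k) * (blockSum N n u j * NormedSpace.exp (aeval (fourier 1) q)))
      = 0 := by
  rw [blockSum, smul_mul_assoc, mul_smul_comm, map_smul, sum_mul, mul_sum, map_sum,
    sum_eq_zero, smul_zero]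
  intro i hi
  obtain ⟨_, rfl⟩ := Finset.mem_filter.1 hi
  have hik : i < k := by
    by_contra! h
    exact hj.not_ge (Nat.log_mono_right (by omega))
  rw [smul_mul_assoc, mul_smul_comm, map_smul, ← mul_assoc, fourier_mul_fourier,
    circleMean_fourier_mul_exp (by linarith [hn i k hik hk]), smul_zero]

end Blocks

lemma norm_circleMean_fourier_mul_exp_sub_one_le (ν : ℤ) (f : C(UnitAddCircle, ℂ)) {ε A : ℝ}
    (hε : 0 ≤ ε) (p : ℕ → ℂ[X]) (s : Finset ℕ) {B : ℕ → ℝ} (hA : 0 < A) (hB : ∀ i, 0 < B i)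
    (hp : ∀ i t, 0 ≤ (aeval (fourier 1 : C(UnitAddCircle, ℂ)) (p i) t).re)
    (hf : ∫ t, ‖f t‖ ^ 2 ∂haarAddCircle ≤ A ^ 2)
    (hpB : ∀ i, ∫ t, ‖aeval (fourier 1 : C(UnitAddCircle, ℂ)) (p i) t‖ ^ 2 ∂haarAddCircle
      ≤ B i ^ 2) :
    ‖circleMean (fourier ν * (f * NormedSpace.exp (aeval (fourier 1) (-((ε : ℂ) • ∑ i ∈ s, p i)))))
        - circleMean (fourier ν * f)‖ ≤ ε * (A * ∑ i ∈ s, B i) := by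
  have haeval : ∀ t, aeval (fourier 1 : C(UnitAddCircle, ℂ)) (-((ε : ℂ) • ∑ i ∈ s, p i)) t
      = -(ε * ∑ i ∈ s, aeval (fourier 1 : C(UnitAddCircle, ℂ)) (p i) t) := fun t => by
    rw [map_neg, map_smul, map_sum, ContinuousMap.neg_apply, ContinuousMap.smul_apply,
      ContinuousMap.sum_apply, smul_eq_mul]
  rw [← map_sub]
  refine (norm_circleMean_le _).trans ?_
  calc _ ≤ ∫ t, ε * ∑ i ∈ s, ‖f t‖ * ‖aeval (fourier 1 : C(UnitAddCircle, ℂ)) (p i) t‖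
          ∂haarAddCircle := by
        refine integral_mono (Continuous.integrable_haarAddCircle (by fun_prop))
          (Continuous.integrable_haarAddCircle (by fun_prop)) fun t => ?_
        have h1 : ‖Complex.exp (-(ε * ∑ i ∈ s, aeval (fourier 1 : C(UnitAddCircle, ℂ)) (p i) t))
            - 1‖ ≤ ε * ∑ i ∈ s, ‖aeval (fourier 1 : C(UnitAddCircle, ℂ)) (p i) t‖ := by
          refine (norm_exp_neg_sub_one_le ?_).trans ?_
          · rw [Complex.re_ofReal_mul, Complex.re_sum]
            exact mul_nonneg hε (sum_nonneg fun i _ => hp i t)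
          · rw [norm_mul, Complex.norm_real, Real.norm_of_nonneg hε]
            exact mul_le_mul_of_nonneg_left (norm_sum_le _ _) hε
        have h2 : (fourier ν * (f * NormedSpace.exp
            (aeval (fourier 1) (-((ε : ℂ) • ∑ i ∈ s, p i)))) - fourier ν * f :
              C(UnitAddCircle, ℂ)) t
            = fourier ν t * (f t * (Complex.exp
              (-(ε * ∑ i ∈ s, aeval (fourier 1 : C(UnitAddCircle, ℂ)) (p i) t)) - 1)) := by
          rw [ContinuousMap.sub_apply, ContinuousMap.mul_apply, ContinuousMap.mul_apply,
            ContinuousMap.mul_apply, normedSpaceExp_apply, haeval]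
          ring
        simp only
        rw [h2, norm_mul, fourier_apply, Circle.norm_coe, one_mul, norm_mul, ← mul_sum,
          mul_left_comm]
        exact mul_le_mul_of_nonneg_left h1 (norm_nonneg _)
    _ = ε * ∑ i ∈ s, ∫ t, ‖f t‖ * ‖aeval (fourier 1 : C(UnitAddCircle, ℂ)) (p i) t‖
          ∂haarAddCircle := by
        rw [integral_const_mul, integral_finsetSum _ fun i _ =>
          Continuous.integrable_haarAddCircle (by fun_prop)]
    _ ≤ ε * (A * ∑ i ∈ s, B i) := by
        rw [mul_sum s B]
        exact mul_le_mul_of_nonneg_left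
          (sum_le_sum fun i _ => integral_norm_mul_norm_le hA (hB i) hf (hpB i)) hε

/-- The dual function: a bounded function whose Fourier coefficients at the given frequencies
are close to prescribed values of size comparable to `1 / (k + 1)`. -/
lemma exists_bounded_circleMean_near {N : ℕ} {n : ℕ → ℤ} {u : ℕ → ℂ}
    (hn : ∀ i j, i < j → j ≤ N → n i < n j) (hu : ∀ k, ‖u k‖ ≤ 1) :
    ∃ Φ : C(UnitAddCircle, ℂ), (∀ t, ‖Φ t‖ ≤ 64) ∧ ∀ k ≤ N,
      ‖circleMean (fourier (n k) * Φ) - (1 / 4) ^ Nat.log 4 (k + 1) * u k‖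
        ≤ (1 / 2) * (1 / 4) ^ Nat.log 4 (k + 1) := by
  set f := blockSum N n u with hf
  have hex : ∀ j, ∃ p : ℂ[X], (∀ t, ‖f j t‖ ≤ (aeval (fourier 1 : C(UnitAddCircle, ℂ)) p t).re) ∧
      ∫ t, ‖aeval (fourier 1 : C(UnitAddCircle, ℂ)) p t‖ ^ 2 ∂haarAddCircle
        ≤ (4 * (1 / 2) ^ j) ^ 2 := fun j => by
    obtain ⟨p, hp, hpi⟩ := exists_polynomial_norm_le_re (f j) (η := 4 * (1 / 4) ^ j) (by positivity)
    refine ⟨p, hp, hpi.trans ?_⟩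
    rw [mul_pow, ← pow_mul, mul_comm j 2, pow_mul]
    norm_num
    have := integral_norm_sq_blockSum_le (u := u) hn hu j
    norm_num at this
    linarith
  choose p hp hpi using hex
  have hfi : ∀ j, ∫ t, ‖f j t‖ ^ 2 ∂haarAddCircle ≤ (2 * (1 / 2) ^ j) ^ 2 := fun j => by
    refine (integral_norm_sq_blockSum_le hn hu j).trans ?_
    rw [mul_pow, ← pow_mul, mul_comm j 2, pow_mul]
    norm_num
  set ε : ℝ := 1 / 32 with hε
  let G : ℕ → C(UnitAddCircle, ℂ) := fun j =>
    NormedSpace.exp (aeval (fourier 1) (-((ε : ℂ) • ∑ i ∈ Ico (j + 1) (N + 1), p i)))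
  refine ⟨∑ j ∈ range (N + 1), f j * G j, fun t => ?_, fun k hk => ?_⟩
  · have h := norm_sum_mul_exp_le (ε := ε) (M := 3) (by norm_num [hε]) (by norm_num [hε])
      (f := fun j => f j t) (h := fun j => aeval (fourier 1 : C(UnitAddCircle, ℂ)) (p j) t)
      (fun j => norm_blockSum_apply_le hu j t) (fun j => hp j t) (N + 1)
    convert h using 2
    · rw [ContinuousMap.sum_apply]
      refine sum_congr rfl fun j _ => ?_
      rw [ContinuousMap.mul_apply, normedSpaceExp_apply, map_neg, map_smul, map_sum, ContinuousMap.neg_apply,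
        ContinuousMap.smul_apply, ContinuousMap.sum_apply, smul_eq_mul]
    · norm_num [hε]
  · set l := Nat.log 4 (k + 1) with hl
    have hlN : l < N + 1 := (Nat.log_lt_self 4 k.succ_ne_zero).trans_le (by omega)
    have hmain : (1 / 4 : ℂ) ^ l * u k = ∑ j ∈ Ico l (N + 1), circleMean (fourier (n k) * f j) := by
      simp only [hf, circleMean_fourier_mul_blockSum hn hk]
      rw [sum_ite_eq, if_pos (by simp; omega)]
    have hsplit : circleMean (fourier (n k) * ∑ j ∈ range (N + 1), f j * G j)
        = ∑ j ∈ Ico l (N + 1), circleMean (fourier (n k) * (f j * G j)) := by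
      rw [mul_sum, map_sum, range_eq_Ico, ← sum_Ico_consecutive _ (Nat.zero_le l) hlN.le,
        sum_eq_zero, zero_add]
      intro j hj
      exact circleMean_fourier_mul_blockSum_mul_exp hn hk (Finset.mem_Ico.1 hj).2 _
    rw [hmain, hsplit, ← sum_sub_distrib]
    calc _ ≤ ∑ j ∈ Ico l (N + 1), (1 / 4) * (1 / 4 : ℝ) ^ j := by
          refine norm_sum_le_of_le _ fun j _ => ?_
          refine (norm_circleMean_fourier_mul_exp_sub_one_le (n k) (f j) (by norm_num [hε]) p
            (Ico (j + 1) (N + 1)) (A := 2 * (1 / 2) ^ j) (B := fun i => 4 * (1 / 2) ^ i)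
            (by positivity) (fun i => by positivity) (fun i t => (norm_nonneg _).trans (hp i t))
            (hfi j) hpi).trans ?_
          rw [← mul_sum]
          have hg := geom_sum_Ico_le_of_lt_one (x := (1 / 2 : ℝ)) (m := j + 1) (n := N + 1)
            (by norm_num) (by norm_num)
          have hpow : (1 / 4 : ℝ) ^ j = (1 / 2) ^ j * (1 / 2) ^ j := by
            rw [← mul_pow]; norm_num
          rw [pow_succ, show (1 : ℝ) - 1 / 2 = 1 / 2 by norm_num,
            mul_div_cancel_right₀ _ (by norm_num)] at hg
          have h0 : (0 : ℝ) < (1 / 2) ^ j := by positivity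
          rw [hpow, hε]
          linarith [mul_le_mul_of_nonneg_left hg h0.le]
      _ ≤ _ := by
          rw [← mul_sum]
          have hg := geom_sum_Ico_le_of_lt_one (x := (1 / 4 : ℝ)) (m := l) (n := N + 1)
            (by norm_num) (by norm_num)
          rw [show (1 : ℝ) - 1 / 4 = 3 / 4 by norm_num] at hg
          have h0 : (0 : ℝ) < (1 / 4) ^ l := by positivity
          linarith

/-- The Mc Gehee–Pigno–Smith inequality on the unit circle. -/
theorem mcGehee_pigno_smith {N : ℕ} {n : ℕ → ℤ} (hn : ∀ i j, i < j → j ≤ N → n i < n j)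
    (a : ℕ → ℂ) :
    1 / 128 * ∑ k ∈ range (N + 1), ‖a k‖ / (k + 1) ≤
      ∫ t, ‖(∑ k ∈ range (N + 1), a k • fourier (n k) : C(UnitAddCircle, ℂ)) t‖ ∂haarAddCircle := by
  let u : ℕ → ℂ := fun k => starRingEnd ℂ (a k) / ‖a k‖
  have hu : ∀ k, ‖u k‖ ≤ 1 := fun k => by simpa [u] using div_self_le_one _
  have hau : ∀ k, a k * u k = ‖a k‖ := fun k => by
    rw [← mul_div_assoc, Complex.mul_conj', pow_two, mul_self_div_self]
  obtain ⟨Φ, hΦ, hΦn⟩ := exists_bounded_circleMean_near hn hu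
  set F : C(UnitAddCircle, ℂ) := ∑ k ∈ range (N + 1), a k • fourier (n k) with hF
  have hupper : ‖circleMean (F * Φ)‖ ≤ 64 * ∫ t, ‖F t‖ ∂haarAddCircle := by
    refine (norm_circleMean_le _).trans ?_
    rw [← integral_const_mul]
    refine integral_mono (Continuous.integrable_haarAddCircle (by fun_prop))
      (Continuous.integrable_haarAddCircle (by fun_prop)) fun t => ?_
    simp only
    rw [ContinuousMap.mul_apply, norm_mul, mul_comm]
    exact mul_le_mul_of_nonneg_right (hΦ t) (norm_nonneg _)
  have hlower : 1 / 2 * ∑ k ∈ range (N + 1), ‖a k‖ / (k + 1) ≤ (circleMean (F * Φ)).re := by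
    rw [hF, sum_mul, map_sum, Complex.re_sum, mul_sum]
    refine sum_le_sum fun k hk => ?_
    have hk' : k ≤ N := by simpa [Nat.lt_succ_iff] using hk
    rw [smul_mul_assoc, map_smul, smul_eq_mul]
    set l := Nat.log 4 (k + 1)
    set z := circleMean (fourier (n k) * Φ)
    have hz : a k * z = ((‖a k‖ * (1 / 4) ^ l : ℝ) : ℂ) + a k * (z - (1 / 4) ^ l * u k) := by
      push_cast
      rw [← hau]
      ring
    have herr : |(a k * (z - (1 / 4) ^ l * u k)).re| ≤ ‖a k‖ * (1 / 2 * (1 / 4) ^ l) := by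
      refine (Complex.abs_re_le_norm _).trans ?_
      rw [norm_mul]
      exact mul_le_mul_of_nonneg_left (hΦn k hk') (norm_nonneg _)
    have hl : (1 : ℝ) / (k + 1) ≤ (1 / 4) ^ l := by
      rw [one_div_pow]
      refine one_div_le_one_div_of_le (by positivity) ?_
      exact_mod_cast Nat.pow_log_le_self 4 k.succ_ne_zero
    have hl' := mul_le_mul_of_nonneg_left hl (norm_nonneg (a k))
    rw [mul_one_div] at hl'
    rw [hz, Complex.add_re, Complex.ofReal_re]
    linarith [(abs_le.1 herr).1]
  linarith [Complex.re_le_norm (circleMean (F * Φ))]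

theorem stmt_13 :
    ∃ C : ℝ, 0 < C ∧
      (∀ (N : ℕ) (n : ℕ → ℤ) (a : ℕ → ℂ),
        (∀ k < N, n k < n (k + 1)) →
        (∫ t in (0 : ℝ)..1,
            ‖∑ k ∈ Finset.range (N + 1),
                a k * Complex.exp (2 * π * Complex.I * (n k : ℂ) * t)‖)
          ≥ C * ∑ k ∈ Finset.range (N + 1), ‖a k‖ / (k + 1)) ∧
      (∀ (N : ℕ) (n : ℕ → ℤ),
        (∀ k < N, n k < n (k + 1)) →
        (∫ t in (0 : ℝ)..1,
            ‖∑ k ∈ Finset.range (N + 1),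
                Complex.exp (2 * π * Complex.I * (n k : ℂ) * t)‖)
          ≥ C * Real.log (N + 1)) := by
  have key : ∀ (N : ℕ) (n : ℕ → ℤ) (a : ℕ → ℂ), (∀ k < N, n k < n (k + 1)) →
      1 / 128 * ∑ k ∈ Finset.range (N + 1), ‖a k‖ / (k + 1) ≤
        ∫ t in (0 : ℝ)..1, ‖∑ k ∈ Finset.range (N + 1),
          a k * Complex.exp (2 * π * Complex.I * (n k : ℂ) * t)‖ := by
    intro N n a hn
    have hlt : ∀ i j, i < j → j ≤ N → n i < n j := by
      intro i j hij
      induction j, hij using Nat.le_induction with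
      | base => exact fun h => hn i h
      | succ j _ ih => exact fun h => (ih (by omega)).trans (hn j h)
    refine (mcGehee_pigno_smith hlt a).trans_eq ?_
    rw [integral_haarAddCircle, inv_one, one_smul, ← UnitAddCircle.intervalIntegral_preimage 0,
      zero_add]
    refine intervalIntegral.integral_congr fun t _ => ?_
    simp only [ContinuousMap.sum_apply]
    refine congrArg _ (sum_congr rfl fun k _ => ?_)
    rw [ContinuousMap.smul_apply, fourier_coe_apply, smul_eq_mul, Complex.ofReal_one, div_one]
  refine ⟨1 / 128, by norm_num, key, fun N n hn => ?_⟩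
  have h := key N n (fun _ => 1) hn
  have hlog : Real.log (N + 1) ≤ ∑ k ∈ Finset.range (N + 1), ‖(1 : ℂ)‖ / ((k : ℝ) + 1) := by
    have h1 : Real.log (N + 1) ≤ Real.log ((N + 1 + 1 : ℕ) : ℝ) :=
      Real.log_le_log (by positivity) (by push_cast; linarith)
    refine (h1.trans (log_add_one_le_harmonic (N + 1))).trans_eq ?_
    simp [harmonic]
  simp only [one_mul] at h
  linarith
end

section
/- There exist an absolute constant $c > 0$ and an integer $N_0$ such that for every $N \ge N_0$ there are complex numbers $a_0,\ldots,a_N$ with $|a_j| = 1$ for all $j$ and $\int_0^1 \left|\sum_{j=0}^N a_j e^{2i\pi j t}\right| dt \ge \sqrt{N} - c$. -/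
open Real MeasureTheory Finset

open ComplexConjugate

/-- The character `t ↦ exp (2πikt)` of the circle. -/
noncomputable def trigChar (k : ℤ) (t : ℝ) : ℂ := Complex.exp (2 * π * Complex.I * (k : ℂ) * t)

lemma continuous_trigChar (k : ℤ) : Continuous (trigChar k) := by
  unfold trigChar; fun_prop

lemma trigChar_mul_conj (k l : ℤ) (t : ℝ) :
    trigChar k t * conj (trigChar l t) = trigChar (k - l) t := by
  unfold trigChar
  rw [← Complex.exp_conj, ← Complex.exp_add]
  congr 1
  simp only [map_mul, Complex.conj_I, Complex.conj_ofReal, map_ofNat, map_intCast]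
  push_cast
  ring

lemma integral_trigChar (k : ℤ) : ∫ t in (0 : ℝ)..1, trigChar k t = if k = 0 then 1 else 0 := by
  unfold trigChar
  split_ifs with h
  · simp [h]
  · have hk : 2 * (π : ℂ) * Complex.I * (k : ℂ) ≠ 0 := by
      simp [h, Real.pi_ne_zero]
    rw [integral_exp_mul_complex hk]
    have : Complex.exp (2 * π * Complex.I * (k : ℂ)) = 1 := by
      rw [← Complex.exp_int_mul_two_pi_mul_I k]
      congr 1; ring
    simp [this]

lemma norm_sq_trigSum (S : Finset ℤ) (b : ℤ → ℂ) (t : ℝ) :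
    ((‖∑ k ∈ S, b k * trigChar k t‖ ^ 2 : ℝ) : ℂ) =
      ∑ p ∈ S ×ˢ S, b p.1 * conj (b p.2) * trigChar (p.1 - p.2) t := by
  rw [← Complex.normSq_eq_norm_sq, ← Complex.mul_conj, map_sum, Finset.sum_mul_sum,
    ← Finset.sum_product']
  refine Finset.sum_congr rfl fun p _ => ?_
  rw [← trigChar_mul_conj, map_mul]
  ring

/-- Parseval's identity for trigonometric polynomials. -/
lemma integral_norm_sq_trigSum (S : Finset ℤ) (b : ℤ → ℂ) :
    ∫ t in (0 : ℝ)..1, ‖∑ k ∈ S, b k * trigChar k t‖ ^ 2 = ∑ k ∈ S, ‖b k‖ ^ 2 := by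
  apply Complex.ofReal_injective
  rw [← intervalIntegral.integral_ofReal]
  simp_rw [norm_sq_trigSum]
  rw [intervalIntegral.integral_finsetSum
    (fun p _ => ((continuous_trigChar _).const_mul _).intervalIntegrable _ _)]
  simp_rw [intervalIntegral.integral_const_mul, integral_trigChar, sub_eq_zero]
  rw [Finset.sum_product, Complex.ofReal_sum]
  refine Finset.sum_congr rfl fun k hk => ?_
  simp [hk, Complex.mul_conj, Complex.normSq_eq_norm_sq]

/-- The autocorrelation of `b` over `S` at shift `k`. -/
noncomputable def autocorr (S : Finset ℤ) (b : ℤ → ℂ) (k : ℤ) : ℂ :=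
  ∑ p ∈ S ×ˢ S with p.1 - p.2 = k, b p.1 * conj (b p.2)

lemma integral_norm_pow_four_trigSum (S D : Finset ℤ) (b : ℤ → ℂ)
    (hD : ∀ k ∈ S, ∀ l ∈ S, k - l ∈ D) :
    ∫ t in (0 : ℝ)..1, ‖∑ k ∈ S, b k * trigChar k t‖ ^ 4 =
      ∑ k ∈ D, ‖autocorr S b k‖ ^ 2 := by
  rw [← integral_norm_sq_trigSum]
  congr 1
  ext t
  have h : ∑ k ∈ D, autocorr S b k * trigChar k t =
      ((‖∑ k ∈ S, b k * trigChar k t‖ ^ 2 : ℝ) : ℂ) := by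
    rw [norm_sq_trigSum, ← Finset.sum_fiberwise_of_maps_to (t := D) (g := fun p => p.1 - p.2)
      (fun p hp => hD _ (Finset.mem_product.1 hp).1 _ (Finset.mem_product.1 hp).2)]
    refine Finset.sum_congr rfl fun k _ => ?_
    rw [autocorr, Finset.sum_mul]
    refine Finset.sum_congr rfl fun p hp => ?_
    rw [(Finset.mem_filter.1 hp).2]
  rw [h, Complex.norm_real, Real.norm_of_nonneg (by positivity)]
  ring

lemma norm_autocorr_neg (S : Finset ℤ) (b : ℤ → ℂ) (k : ℤ) :
    ‖autocorr S b (-k)‖ = ‖autocorr S b k‖ := by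
  rw [← Complex.norm_conj (autocorr S b k)]
  congr 1
  unfold autocorr
  rw [map_sum]
  refine Finset.sum_nbij' Prod.swap Prod.swap ?_ ?_ (by simp) (by simp) ?_
  · simp only [Finset.mem_filter, Finset.mem_product, Prod.fst_swap, Prod.snd_swap]
    exact fun p hp => ⟨hp.1.symm, by omega⟩
  · simp only [Finset.mem_filter, Finset.mem_product, Prod.fst_swap, Prod.snd_swap]
    exact fun p hp => ⟨hp.1.symm, by omega⟩
  · intro p _
    simp [mul_comm]

/-- Newman's quadratic phases `exp (πij²/n)`. -/
noncomputable def newmanCoeff (n : ℕ) (j : ℤ) : ℂ :=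
  Complex.exp (((π * (j : ℝ) ^ 2 / n : ℝ) : ℂ) * Complex.I)

lemma norm_newmanCoeff (n : ℕ) (j : ℤ) : ‖newmanCoeff n j‖ = 1 :=
  Complex.norm_exp_ofReal_mul_I _

lemma newmanCoeff_mul_conj (n k j : ℕ) :
    newmanCoeff n (j + k) * conj (newmanCoeff n j) =
      newmanCoeff n k * Complex.exp (Complex.I * ((2 * π * k / n : ℝ) : ℂ)) ^ j := by
  unfold newmanCoeff
  rw [← Complex.exp_conj, ← Complex.exp_add, ← Complex.exp_nat_mul, ← Complex.exp_add]
  congr 1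
  simp only [map_mul, Complex.conj_I, Complex.conj_ofReal]
  push_cast
  ring

lemma norm_autocorr_newmanCoeff {n k : ℕ} (hk : k ≤ n) :
    ‖autocorr (Finset.Ico 0 (n : ℤ)) (newmanCoeff n) k‖ =
      ‖∑ j ∈ Finset.range (n - k), Complex.exp (Complex.I * ((2 * π * k / n : ℝ) : ℂ)) ^ j‖ := by
  have h : autocorr (Finset.Ico 0 (n : ℤ)) (newmanCoeff n) k =
      ∑ j ∈ Finset.range (n - k), newmanCoeff n (j + k) * conj (newmanCoeff n j) := by
    unfold autocorr
    symm
    refine Finset.sum_nbij' (fun j : ℕ => ((j + k : ℤ), (j : ℤ))) (fun p => p.2.toNat) ?_ ?_ ?_ ?_ ?_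
    · simp only [Finset.mem_filter, Finset.mem_product, Finset.mem_Ico, Finset.mem_range]
      omega
    · simp only [Finset.mem_filter, Finset.mem_product, Finset.mem_Ico, Finset.mem_range]
      omega
    · simp
    · rintro ⟨x, y⟩
      simp only [Finset.mem_filter, Finset.mem_product, Finset.mem_Ico, Prod.mk.injEq]
      omega
    · simp
  simp_rw [h, newmanCoeff_mul_conj, ← Finset.mul_sum, norm_mul, norm_newmanCoeff, one_mul]

lemma norm_autocorr_newmanCoeff_zero (n : ℕ) :
    ‖autocorr (Finset.Ico 0 (n : ℤ)) (newmanCoeff n) 0‖ = n := by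
  have h := norm_autocorr_newmanCoeff (Nat.zero_le n)
  simpa using h

lemma two_mul_min_div_le_sin {n k : ℕ} (hk : k < n) :
    2 * (min k (n - k) : ℕ) / (n : ℝ) ≤ Real.sin (π * k / n) := by
  have hn : (0 : ℝ) < n := by exact_mod_cast (Nat.zero_le k).trans_lt hk
  have key : ∀ m : ℕ, 2 * m ≤ n → 2 * (m : ℝ) / n ≤ Real.sin (π * m / n) := by
    intro m hm
    have hm' : 2 * (m : ℝ) ≤ n := by exact_mod_cast hm
    have h := Real.mul_le_sin (x := π * m / n) (by positivity) (by
      rw [div_le_div_iff₀ hn two_pos]; nlinarith [Real.pi_pos])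
    refine le_trans (le_of_eq ?_) h
    field_simp
  rcases le_total k (n - k) with h | h
  · rw [min_eq_left h]; exact key k (by omega)
  · rw [min_eq_right h]
    have h' := key (n - k) (by omega)
    rwa [Nat.cast_sub hk.le, show π * ((n : ℝ) - k) / n = π - π * k / n by field_simp,
      Real.sin_pi_sub, ← Nat.cast_sub hk.le] at h'

/-- Partial geometric sums of a nontrivial `n`-th root of unity. -/
lemma norm_geom_sum_le {n k : ℕ} (hk0 : 0 < k) (hk : k < n) :
    ‖∑ j ∈ Finset.range (n - k), Complex.exp (Complex.I * ((2 * π * k / n : ℝ) : ℂ)) ^ j‖ ≤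
        (min k (n - k) : ℕ) ∧
      ‖∑ j ∈ Finset.range (n - k), Complex.exp (Complex.I * ((2 * π * k / n : ℝ) : ℂ)) ^ j‖ *
        (min k (n - k) : ℕ) ≤ n := by
  have hn : (0 : ℝ) < n := by exact_mod_cast hk0.trans hk
  have hm0 : 0 < min k (n - k) := by omega
  set m := min k (n - k) with hm
  set z := Complex.exp (Complex.I * ((2 * π * k / n : ℝ) : ℂ)) with hz
  have hz1 : ‖z‖ = 1 := Complex.norm_exp_I_mul_ofReal _
  have hzn : z ^ n = 1 := by
    rw [hz, ← Complex.exp_nat_mul, ← Complex.exp_int_mul_two_pi_mul_I k]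
    congr 1
    have : (n : ℂ) ≠ 0 := by exact_mod_cast hn.ne'
    push_cast
    field_simp
  have hsin : 4 * (m : ℝ) / n ≤ ‖z - 1‖ := by
    rw [hz, Complex.norm_exp_I_mul_ofReal_sub_one, norm_mul, Real.norm_two,
      show 2 * π * k / n / 2 = π * k / n by ring]
    have h1 := two_mul_min_div_le_sin hk
    have h2 := Real.le_norm_self (Real.sin (π * k / n))
    rw [← hm] at h1
    calc 4 * (m : ℝ) / n = 2 * (2 * m / n) := by ring
      _ ≤ _ := by linarith
  have hne : z - 1 ≠ 0 := by
    rw [← norm_pos_iff]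
    exact lt_of_lt_of_le (by positivity) hsin
  have hsum : ∀ l : ℕ → ℕ, ∀ r, ‖∑ j ∈ Finset.range r, z ^ l j‖ ≤ r := by
    intro l r
    refine (norm_sum_le _ _).trans (by simp [hz1])
  constructor
  · have h0 : ∑ j ∈ Finset.range n, z ^ j = 0 := by
      have := geom_sum_mul z n
      rw [hzn, sub_self] at this
      exact (mul_eq_zero.1 this).resolve_right hne
    have hsplit := Finset.sum_range_add (fun j => z ^ j) (n - k) k
    rw [Nat.sub_add_cancel hk.le, h0] at hsplit
    rw [hm, Nat.cast_min, le_min_iff]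
    refine ⟨?_, hsum id _⟩
    rw [eq_neg_of_add_eq_zero_left hsplit.symm, norm_neg]
    exact hsum (fun j => n - k + j) k
  · have hmul := congrArg norm (geom_sum_mul z (n - k))
    rw [norm_mul] at hmul
    have h2 : ‖z ^ (n - k) - 1‖ ≤ 2 := by
      refine (norm_sub_le _ _).trans ?_
      simp [hz1]; norm_num
    set s := ‖∑ j ∈ Finset.range (n - k), z ^ j‖
    have hs : 0 ≤ s := norm_nonneg _
    have h3 : s * (4 * m / n) ≤ 2 := by
      rw [← hmul] at h2
      exact (mul_le_mul_of_nonneg_left hsin hs).trans h2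
    rw [← mul_div_assoc, div_le_iff₀ hn] at h3
    linarith

lemma sq_le_telescope {s m n : ℝ} (hs : 0 ≤ s) (hm : 1 ≤ m) (hn : 0 < n) (h1 : s ≤ m)
    (h2 : s * m ≤ n) : s ^ 2 ≤ 4 * n ^ 2 * (1 / (√n + (m - 1)) - 1 / (√n + m)) := by
  have hr : 0 < √n := Real.sqrt_pos.2 hn
  have hrr : √n ^ 2 = n := Real.sq_sqrt hn.le
  have hsr : s ≤ √n := Real.le_sqrt_of_sq_le (by nlinarith)
  have h3 : (√n + m) * s ≤ 2 * n := by nlinarith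
  have h4 : ((√n + m) * s) ^ 2 ≤ (2 * n) ^ 2 := pow_le_pow_left₀ (by positivity) h3 2
  have hp : 0 < √n + (m - 1) := by linarith
  have hq : 0 < √n + m := by linarith
  rw [div_sub_div _ _ hp.ne' hq.ne', ← mul_div_assoc, le_div_iff₀ (by positivity)]
  nlinarith [mul_nonneg (sq_nonneg s) hq.le]

lemma sum_norm_autocorr_sq_le {n : ℕ} (hn : 0 < n) :
    ∑ k ∈ Finset.Ico 1 n, ‖autocorr (Finset.Ico 0 (n : ℤ)) (newmanCoeff n) k‖ ^ 2 ≤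
      8 * (n * √n) := by
  have hn' : (0 : ℝ) < n := by exact_mod_cast hn
  have hr : 0 < √(n : ℝ) := Real.sqrt_pos.2 hn'
  set f : ℕ → ℝ := fun m => 4 * (n : ℝ) ^ 2 * (1 / (√n + ((m : ℝ) - 1)) - 1 / (√n + m)) with hf
  have hf0 : ∀ m, 1 ≤ m → 0 ≤ f m := by
    intro m hm
    have hm' : (1 : ℝ) ≤ m := by exact_mod_cast hm
    simpa [hf] using sq_le_telescope (s := 0) le_rfl hm' hn' (by linarith) (by simp)
  have hbound : ∀ k ∈ Finset.Ico 1 n,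
      ‖autocorr (Finset.Ico 0 (n : ℤ)) (newmanCoeff n) k‖ ^ 2 ≤ f k + f (n - k) := by
    intro k hk
    obtain ⟨hk1, hk2⟩ := Finset.mem_Ico.1 hk
    obtain ⟨h1, h2⟩ := norm_geom_sum_le hk1 hk2
    rw [← norm_autocorr_newmanCoeff hk2.le] at h1 h2
    have h3 := sq_le_telescope (norm_nonneg _)
      (by exact_mod_cast (by omega : 1 ≤ min k (n - k))) hn' h1 h2
    refine h3.trans ?_
    change f (min k (n - k)) ≤ _
    have ha := hf0 k hk1
    have hb := hf0 (n - k) (by omega)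
    rcases min_choice k (n - k) with h | h <;> rw [h] <;> linarith
  have hsum : ∑ k ∈ Finset.Ico 1 n, f k ≤ 4 * (n * √n) := by
    have htel : ∀ r : ℕ, ∑ j ∈ Finset.range r, f (1 + j) =
        4 * (n : ℝ) ^ 2 * (1 / √n - 1 / (√n + r)) := by
      intro r
      have := Finset.sum_range_sub' (fun j : ℕ => 1 / (√(n : ℝ) + j)) r
      simp only [Nat.cast_zero, add_zero] at this
      rw [← this, Finset.mul_sum]
      refine Finset.sum_congr rfl fun j _ => ?_
      simp only [hf]
      push_cast
      ring_nf
    rw [Finset.sum_Ico_eq_sum_range, htel]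
    have h1 : (0 : ℝ) ≤ 1 / (√n + (n - 1 : ℕ)) := by positivity
    have h2 : (n : ℝ) ^ 2 * (1 / √n) = n * √n := by
      field_simp
      rw [Real.sq_sqrt hn'.le]
    nlinarith [mul_nonneg (sq_nonneg (n : ℝ)) h1]
  have hrefl : ∑ k ∈ Finset.Ico 1 n, f (n - k) = ∑ k ∈ Finset.Ico 1 n, f k := by
    refine Finset.sum_nbij' (fun k => n - k) (fun k => n - k) ?_ ?_ ?_ ?_ (fun _ _ => rfl) <;>
    · intro k hk
      simp only [Finset.mem_Ico] at hk ⊢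
      omega
  refine (Finset.sum_le_sum hbound).trans ?_
  rw [Finset.sum_add_distrib, hrefl]
  linarith

/-- Newman's fourth moment estimate. -/
lemma integral_norm_pow_four_newman_le {n : ℕ} (hn : 0 < n) :
    ∫ t in (0 : ℝ)..1, ‖∑ k ∈ Finset.Ico 0 (n : ℤ), newmanCoeff n k * trigChar k t‖ ^ 4 ≤
      n ^ 2 + 16 * (n * √n) := by
  set e : ℕ → ℤ := fun k => k
  set e' : ℕ → ℤ := fun k => -(k : ℤ)
  have hD : ∀ k ∈ Finset.Ico 0 (n : ℤ), ∀ l ∈ Finset.Ico 0 (n : ℤ),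
      k - l ∈ insert 0 ((Finset.Ico 1 n).image e ∪ (Finset.Ico 1 n).image e') := by
    intro k hk l hl
    simp only [Finset.mem_Ico] at hk hl
    simp only [Finset.mem_insert, Finset.mem_union, Finset.mem_image, Finset.mem_Ico, e, e']
    rcases lt_trichotomy k l with h | h | h
    · exact Or.inr (Or.inr ⟨(l - k).toNat, by omega, by omega⟩)
    · exact Or.inl (by omega)
    · exact Or.inr (Or.inl ⟨(k - l).toNat, by omega, by omega⟩)
  rw [integral_norm_pow_four_trigSum _ _ _ hD, Finset.sum_insert, Finset.sum_union,
    Finset.sum_image, Finset.sum_image, norm_autocorr_newmanCoeff_zero]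
  · simp only [e, e', norm_autocorr_neg]
    linarith [sum_norm_autocorr_sq_le hn]
  · intro a _ b _ h
    simpa [e'] using h
  · intro a _ b _ h
    simpa [e] using h
  · rw [Finset.disjoint_left]
    simp only [Finset.mem_image, Finset.mem_Ico, e, e']
    rintro _ ⟨a, ha, rfl⟩ ⟨b, hb, h⟩
    omega
  · simp only [Finset.mem_union, Finset.mem_image, Finset.mem_Ico, e, e']
    rintro (⟨a, ha, h⟩ | ⟨a, ha, h⟩) <;> omega

/-- A lower bound for the first moment in terms of the second and the fourth. -/
lemma integral_ge_of_moments {g : ℝ → ℝ} (hg : Continuous g) (hg0 : ∀ t, 0 ≤ g t) {r C : ℝ}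
    (hr : 0 < r) (h2 : ∫ t in (0 : ℝ)..1, g t ^ 2 = r ^ 2)
    (h4 : ∫ t in (0 : ℝ)..1, g t ^ 4 ≤ r ^ 4 + C * r ^ 3) :
    r - C / 2 ≤ ∫ t in (0 : ℝ)..1, g t := by
  have hpt : ∀ x : ℝ, 0 ≤ x → 3 * r ^ 2 * x ^ 2 - x ^ 4 ≤ 2 * r ^ 3 * x := by
    intro x hx
    have h : 0 ≤ x * (x - r) ^ 2 * (x + 2 * r) := by positivity
    nlinarith
  have hmono : ∫ t in (0 : ℝ)..1, (3 * r ^ 2 * g t ^ 2 - g t ^ 4) ≤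
      ∫ t in (0 : ℝ)..1, 2 * r ^ 3 * g t := by
    refine intervalIntegral.integral_mono zero_le_one
      (Continuous.intervalIntegrable (by fun_prop) _ _)
      (Continuous.intervalIntegrable (by fun_prop) _ _) fun t => hpt _ (hg0 t)
  rw [intervalIntegral.integral_sub (Continuous.intervalIntegrable (by fun_prop) _ _)
      (Continuous.intervalIntegrable (by fun_prop) _ _), intervalIntegral.integral_const_mul,
    intervalIntegral.integral_const_mul, h2] at hmono
  have h3 : 2 * r ^ 3 * (r - C / 2) ≤ 2 * r ^ 3 * ∫ t in (0 : ℝ)..1, g t := by nlinarith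
  exact le_of_mul_le_mul_left h3 (by positivity)

theorem stmt_18 :
    ∃ c : ℝ, 0 < c ∧ ∃ N₀ : ℕ,
      ∀ N : ℕ, N₀ ≤ N →
        ∃ a : ℕ → ℂ, (∀ j ≤ N, ‖a j‖ = 1) ∧
          (∫ t in (0 : ℝ)..1,
              ‖∑ j ∈ Finset.range (N + 1),
                  a j * Complex.exp (2 * π * Complex.I * (j : ℂ) * t)‖)
            ≥ Real.sqrt N - c := by
  refine ⟨8, by norm_num, 0, fun N _ => ⟨fun j => newmanCoeff (N + 1) j,
    fun j _ => norm_newmanCoeff _ _, ?_⟩⟩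
  have hn : (0 : ℝ) < (N + 1 : ℕ) := by positivity
  have hrr : √((N + 1 : ℕ) : ℝ) ^ 2 = (N + 1 : ℕ) := Real.sq_sqrt hn.le
  have heq : ∀ t : ℝ, ∑ j ∈ Finset.range (N + 1),
      newmanCoeff (N + 1) j * Complex.exp (2 * π * Complex.I * (j : ℂ) * t) =
      ∑ k ∈ Finset.Ico 0 ((N + 1 : ℕ) : ℤ), newmanCoeff (N + 1) k * trigChar k t := by
    intro t
    refine Finset.sum_nbij' (fun j : ℕ => (j : ℤ)) Int.toNat ?_ ?_ ?_ ?_ ?_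
    · simp only [Finset.mem_Ico, Finset.mem_range]; omega
    · simp only [Finset.mem_Ico, Finset.mem_range]; omega
    · simp
    · simp only [Finset.mem_Ico]; omega
    · simp [trigChar]
  simp_rw [heq]
  have hcont : Continuous fun t : ℝ =>
      ‖∑ k ∈ Finset.Ico 0 ((N + 1 : ℕ) : ℤ), newmanCoeff (N + 1) k * trigChar k t‖ :=
    (continuous_finsetSum _ fun k _ => (continuous_trigChar k).const_mul _).norm
  have h := integral_ge_of_moments (C := 16) hcont (fun t => norm_nonneg _)
    (Real.sqrt_pos.2 hn) (by
      rw [integral_norm_sq_trigSum, hrr]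
      simp [norm_newmanCoeff]) (by
      refine (integral_norm_pow_four_newman_le N.succ_pos).trans (le_of_eq ?_)
      rw [Nat.succ_eq_add_one]
      linear_combination (-((N + 1 : ℕ) : ℝ) - √((N + 1 : ℕ) : ℝ) ^ 2
        - 16 * √((N + 1 : ℕ) : ℝ)) * hrr)
  have hmono : √(N : ℝ) ≤ √((N + 1 : ℕ) : ℝ) := Real.sqrt_le_sqrt (by push_cast; linarith)
  linarith
end
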